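/- Let X be a GC_5 set of 21 nodes with no maximal line. Then no node of X has m-distribution sequence (5,5,5,3,2). -/

import Mathlib

open MvPolynomial

/-- Evaluation of a bivariate polynomial at a point of the real plane. -/
noncomputable def ev (p : MvPolynomial (Fin 2) ℝ) (A : ℝ × ℝ) : ℝ :=
  MvPolynomial.eval ![A.1, A.2] p

/-- A polynomial of total degree exactly 1, defining a line. -/
def IsLinePoly (l : MvPolynomial (Fin 2) ℝ) : Prop := l.totalDegree = 1

/-- The line (zero set) defined by a polynomial. -/
def lineSet (l : MvPolynomial (Fin 2) ℝ) : Set (ℝ × ℝ) := {A | ev l A = 0}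

/-- The number of nodes of `X` lying on the line defined by `l`. -/
noncomputable def nodesOn (X : Set (ℝ × ℝ)) (l : MvPolynomial (Fin 2) ℝ) : ℕ :=
  (X ∩ lineSet l).ncard

/-- `X` is an `n`-poised set: it has `N = (n+2)(n+1)/2` nodes and the only polynomial of
degree ≤ n vanishing on all of `X` is the zero polynomial. -/
def Poised (n : ℕ) (X : Set (ℝ × ℝ)) : Prop :=
  X.Finite ∧ X.ncard = (n + 2) * (n + 1) / 2 ∧
    ∀ p : MvPolynomial (Fin 2) ℝ, p.totalDegree ≤ n → (∀ A ∈ X, ev p A = 0) → p = 0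

/-- `p` is an `n`-fundamental polynomial of the node `A` with respect to `X`. -/
def IsFund (n : ℕ) (X : Set (ℝ × ℝ)) (A : ℝ × ℝ) (p : MvPolynomial (Fin 2) ℝ) : Prop :=
  p.totalDegree ≤ n ∧ ev p A = 1 ∧ ∀ B ∈ X, B ≠ A → ev p B = 0

/-- `X` is a `GC_n` set: it is `n`-poised and each fundamental polynomial is a product of
`n` linear (degree-1) polynomials. -/
def GCSet (n : ℕ) (X : Set (ℝ × ℝ)) : Prop :=
  Poised n X ∧ ∀ A ∈ X, ∃ p : MvPolynomial (Fin 2) ℝ, IsFund n X A p ∧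
    ∃ f : Fin n → MvPolynomial (Fin 2) ℝ, (∀ i, IsLinePoly (f i)) ∧ p = ∏ i, f i

/-- The node `A` uses the line `l`: the linear polynomial `l` divides a fundamental
polynomial of `A`. -/
def Uses (n : ℕ) (X : Set (ℝ × ℝ)) (A : ℝ × ℝ) (l : MvPolynomial (Fin 2) ℝ) : Prop :=
  ∃ p, IsFund n X A p ∧ l ∣ p

/-- `X` has no maximal line, i.e. no line passes through `n+1` nodes of `X`. -/
def NoMaximalLine (n : ℕ) (X : Set (ℝ × ℝ)) : Prop :=
  ∀ l : MvPolynomial (Fin 2) ℝ, IsLinePoly l → nodesOn X l ≠ n + 1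

/-- Number of nodes of `X` on the line `l` which do not lie on any of the lines
`L 0, …, L (s-1)` (the primary node count of `l` at step `s`). -/
noncomputable def resCount (X : Set (ℝ × ℝ)) (L : Fin 5 → MvPolynomial (Fin 2) ℝ)
    (s : Fin 5) (l : MvPolynomial (Fin 2) ℝ) : ℕ :=
  {B ∈ X | ev l B = 0 ∧ ∀ i : Fin 5, i < s → ev (L i) B ≠ 0}.ncard

/-- `L` is an m-line sequence of the node `A` of the `GC_5` set `X`: it enumerates the five
distinct used lines of `A` (a fundamental polynomial of `A` is, up to a constant, the
product of the `L i`), ordered greedily: at each step `s` the line `L s` has maximal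
primary node count among the remaining used lines. -/
def MLineSeq (X : Set (ℝ × ℝ)) (A : ℝ × ℝ) (L : Fin 5 → MvPolynomial (Fin 2) ℝ) : Prop :=
  (∀ i, IsLinePoly (L i)) ∧
  (∀ i j : Fin 5, i ≠ j → lineSet (L i) ≠ lineSet (L j)) ∧
  (∃ p : MvPolynomial (Fin 2) ℝ, IsFund 5 X A p ∧ ∃ c : ℝ, p = MvPolynomial.C c * ∏ i, L i) ∧
  (∀ s t : Fin 5, s ≤ t → resCount X L s (L t) ≤ resCount X L s (L s))

/-- The node `A` has m-distribution sequence `k`. -/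
def HasMDSeq (X : Set (ℝ × ℝ)) (A : ℝ × ℝ) (k : Fin 5 → ℕ) : Prop :=
  ∃ L : Fin 5 → MvPolynomial (Fin 2) ℝ, MLineSeq X A L ∧ ∀ s, resCount X L s (L s) = k s

/-- Incidence data of a node set with no maximal line: the traces `IsLn` of lines on the nodes, the
traces `M B` of the lines used by a node, and the dimension `rk k N` of the space of polynomials
of degree at most `k` vanishing on `N`. -/
structure LineConfig (α : Type*) [DecidableEq α] where
  X : Finset α
  IsLn : Finset α → Prop
  M : α → Finset (Finset α)
  rk : ℕ → Finset α → ℕ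
  card_X : X.card = 21
  ln_sub : ∀ {a}, IsLn a → a ⊆ X
  ln_card : ∀ {a}, IsLn a → a.card ≤ 5
  ln_eq : ∀ {a b P Q}, IsLn a → IsLn b → P ≠ Q → P ∈ a → Q ∈ a → P ∈ b → Q ∈ b → a = b
  M_ln : ∀ {B m}, B ∈ X → m ∈ M B → IsLn m
  M_not_mem : ∀ {B m}, B ∈ X → m ∈ M B → B ∉ m
  M_cover : ∀ {B P}, B ∈ X → P ∈ X → P ≠ B → ∃ m ∈ M B, P ∈ m
  M_card : ∀ {B}, B ∈ X → (M B).card ≤ 5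
  rk_zero : ∀ N, rk 0 N ≤ 1
  rk_pos : 0 < rk 0 ∅
  rk_step : ∀ {a}, IsLn a → ∀ k N, rk (k + 1) N ≤ (k + 2 - (N ∩ a).card) + rk k (N \ a)
  rk_mul : ∀ {a N N'}, IsLn a → N' ⊆ N ∪ a → ∀ k, rk k N ≤ rk (k + 1) N'
  rk_X : rk 5 X = 0
  rk_users : ∀ {U m}, U ⊆ X → 2 ≤ m.card → (∀ C ∈ U, m ∈ M C) → U.card ≤ rk 4 ((X \ m) \ U)
  cubic_used : ∀ {a b c G}, IsLn a → IsLn b → IsLn c → a.card = 5 → b.card = 5 → c.card = 5 →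
    Disjoint a b → Disjoint a c → Disjoint b c → G ∈ X → G ∉ a → G ∉ b → G ∉ c → a ∈ M G

namespace LineConfig

variable {α : Type*} [DecidableEq α] (K : LineConfig α)

/-- Three pairwise disjoint traces of five nodes each. -/
structure IsCubic (S : Fin 3 → Finset α) : Prop where
  ln : ∀ i, K.IsLn (S i)
  card : ∀ i, (S i).card = 5
  disj : ∀ i j, i ≠ j → Disjoint (S i) (S j)

/-- The nodes on the three lines. -/
def inner (S : Fin 3 → Finset α) : Finset α := Finset.univ.biUnion S

/-- The nodes off the three lines. -/
def outer (S : Fin 3 → Finset α) : Finset α := K.X \ inner S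

/-- A trace meeting each of the three lines in exactly one node. -/
def Transversal (S : Fin 3 → Finset α) (m : Finset α) : Prop := ∀ i, (m ∩ S i).card = 1

variable {K}

theorem inter_card_le {a b : Finset α} (ha : K.IsLn a) (hb : K.IsLn b) (h : a ≠ b) :
    (a ∩ b).card ≤ 1 := by
  by_contra! h1
  obtain ⟨P, hP, Q, hQ, hPQ⟩ := Finset.one_lt_card.1 h1
  simp only [Finset.mem_inter] at hP hQ
  exact h (K.ln_eq ha hb hPQ hP.1 hQ.1 hP.2 hQ.2)

theorem eq_of_two_le {a b : Finset α} (ha : K.IsLn a) (hb : K.IsLn b)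
    (h : 2 ≤ (a ∩ b).card) : a = b := by
  by_contra h1
  have := inter_card_le ha hb h1
  omega

/-- A line containing more still uncovered nodes than there are remaining lines is used. -/
theorem mem_used_of_card_lt {B : α} (hB : B ∈ K.X) {a R : Finset α} (ha : K.IsLn a)
    {T : Finset (Finset α)} (hT : T ⊆ K.M B) (hR : R ⊆ a) (hBR : B ∉ R)
    (hd : ∀ t ∈ T, Disjoint t R) (hc : 5 < R.card + T.card) : a ∈ K.M B := by
  by_contra h
  have hcov : R ⊆ (K.M B \ T).biUnion (fun m => m ∩ a) := by
    intro P hP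
    have hPB : P ≠ B := fun h => hBR (h ▸ hP)
    obtain ⟨m, hm, hPm⟩ := K.M_cover hB (K.ln_sub ha (hR hP)) hPB
    refine Finset.mem_biUnion.2 ⟨m, Finset.mem_sdiff.2 ⟨hm, fun hmT => ?_⟩,
      Finset.mem_inter.2 ⟨hPm, hR hP⟩⟩
    exact Finset.disjoint_left.1 (hd m hmT) hPm hP
  have h1 := Finset.card_le_card hcov
  have h2 : ((K.M B \ T).biUnion (fun m => m ∩ a)).card ≤ (K.M B \ T).card * 1 := by
    refine Finset.card_biUnion_le_card_mul _ _ _ fun m hm => ?_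
    have hm' := (Finset.mem_sdiff.1 hm).1
    exact inter_card_le (K.M_ln hB hm') ha (fun h' => h (h' ▸ hm'))
  have h3 := Finset.card_sdiff_of_subset hT
  have h4 := K.M_card hB
  have h5 := Finset.card_le_card hT
  omega

section Cubic

variable {S : Fin 3 → Finset α}

theorem IsCubic.sub (hS : K.IsCubic S) (i : Fin 3) : S i ⊆ K.X := K.ln_sub (hS.ln i)

theorem mem_inner {P : α} : P ∈ inner S ↔ ∃ i, P ∈ S i := by simp [inner]

theorem IsCubic.inner_sub (hS : K.IsCubic S) : inner S ⊆ K.X :=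
  Finset.biUnion_subset.2 fun i _ => hS.sub i

theorem IsCubic.card_inter_inner (hS : K.IsCubic S) (m : Finset α) :
    (m ∩ inner S).card = ∑ i, (m ∩ S i).card := by
  rw [inner, Finset.inter_biUnion, Finset.card_biUnion]
  intro i _ j _ hij
  exact (hS.disj i j hij).mono Finset.inter_subset_right Finset.inter_subset_right

theorem IsCubic.card_inner (hS : K.IsCubic S) : (inner S).card = 15 := by
  have := hS.card_inter_inner (inner S)
  rw [Finset.inter_self] at this
  rw [this, Finset.sum_congr rfl (g := fun _ => 5)]
  · simp
  · intro i _
    rw [Finset.inter_eq_right.2, hS.card i]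
    exact Finset.subset_biUnion_of_mem S (Finset.mem_univ i)

theorem IsCubic.card_outer (hS : K.IsCubic S) : (K.outer S).card = 6 := by
  rw [outer, Finset.card_sdiff_of_subset hS.inner_sub, K.card_X, hS.card_inner]

theorem IsCubic.card_eq (hS : K.IsCubic S) {m : Finset α} (hm : m ⊆ K.X) :
    m.card = (m ∩ S 0).card + (m ∩ S 1).card + (m ∩ S 2).card + (m ∩ K.outer S).card := by
  have h1 := Finset.card_inter_add_card_sdiff m (inner S)
  rw [hS.card_inter_inner, Fin.sum_univ_three] at h1
  have h2 : m \ inner S = m ∩ K.outer S := by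
    ext P
    simp only [outer, Finset.mem_sdiff, Finset.mem_inter]
    exact ⟨fun h => ⟨h.1, hm h.1, h.2⟩, fun h => ⟨h.1, h.2.2⟩⟩
  rw [← h2]; omega

theorem exists_third : ∀ i j : Fin 3, i ≠ j → ∃ k, k ≠ i ∧ k ≠ j := by decide

theorem IsCubic.not_used (hS : K.IsCubic S) {i : Fin 3} {B : α} (hB : B ∈ S i) (j : Fin 3) :
    S j ∉ K.M B := by
  intro h
  have hBX := hS.sub i hB
  have hij : j ≠ i := by
    rintro rfl
    exact K.M_not_mem hBX h hB
  obtain ⟨k, hkj, hki⟩ := exists_third j i hij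
  have hk : S k ∈ K.M B := by
    refine mem_used_of_card_lt hBX (hS.ln k) (T := {S j}) (by simpa using h) subset_rfl ?_ ?_ ?_
    · exact Finset.disjoint_right.1 (hS.disj k i hki) hB
    · simpa using hS.disj j k hkj.symm
    · rw [hS.card k]; simp
  have hne : S j ≠ S k := by
    intro h1
    have := hS.disj j k hkj.symm
    rw [h1, disjoint_self] at this
    have h2 := hS.card k
    simp [this] at h2
  have hi : S i ∈ K.M B := by
    refine mem_used_of_card_lt hBX (hS.ln i) (T := {S j, S k}) (R := (S i).erase B) ?_
      (Finset.erase_subset _ _) (Finset.notMem_erase _ _) ?_ ?_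
    · intro t; simp only [Finset.mem_insert, Finset.mem_singleton]
      rintro (rfl | rfl) <;> assumption
    · intro t; simp only [Finset.mem_insert, Finset.mem_singleton]
      rintro (rfl | rfl)
      · exact (hS.disj j i hij).mono_right (Finset.erase_subset _ _)
      · exact (hS.disj k i hki).mono_right (Finset.erase_subset _ _)
    · rw [Finset.card_erase_of_mem hB, hS.card, Finset.card_pair hne]; norm_num
  exact K.M_not_mem hBX hi hB

theorem IsCubic.inter_le (hS : K.IsCubic S) {i : Fin 3} {B : α} (hB : B ∈ S i) {m : Finset α}
    (hm : m ∈ K.M B) (j : Fin 3) : (m ∩ S j).card ≤ 1 :=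
  inter_card_le (K.M_ln (hS.sub i hB) hm) (hS.ln j) fun h => hS.not_used hB j (h ▸ hm)

theorem IsCubic.le_sum_inter (hS : K.IsCubic S) {i : Fin 3} {B : α} (hB : B ∈ S i)
    {R : Finset α} (hR : R ⊆ K.X) (hBR : B ∉ R) :
    R.card ≤ ∑ m ∈ K.M B, (m ∩ R).card := by
  have hcov : R ⊆ (K.M B).biUnion (fun m => m ∩ R) := by
    intro P hP
    obtain ⟨m, hm, hPm⟩ := K.M_cover (hS.sub i hB) (hR hP) (fun h => hBR (h ▸ hP))
    exact Finset.mem_biUnion.2 ⟨m, hm, Finset.mem_inter.2 ⟨hPm, hP⟩⟩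
  exact (Finset.card_le_card hcov).trans Finset.card_biUnion_le

theorem IsCubic.card_used (hS : K.IsCubic S) {i : Fin 3} {B : α} (hB : B ∈ S i) :
    (K.M B).card = 5 := by
  obtain ⟨j, hj⟩ : ∃ j, j ≠ i := exists_ne i
  have h1 := hS.le_sum_inter hB (hS.sub j) (Finset.disjoint_right.1 (hS.disj j i hj) hB)
  have h2 : ∑ m ∈ K.M B, (m ∩ S j).card ≤ ∑ m ∈ K.M B, 1 :=
    Finset.sum_le_sum fun m hm => hS.inter_le hB hm j
  have h3 := K.M_card (hS.sub i hB)
  have h4 := hS.card j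
  simp only [Finset.sum_const, smul_eq_mul, mul_one] at h2
  omega

theorem IsCubic.inter_eq_one (hS : K.IsCubic S) {i j : Fin 3} (hj : j ≠ i) {B : α} (hB : B ∈ S i)
    {m : Finset α} (hm : m ∈ K.M B) : (m ∩ S j).card = 1 := by
  have h1 := hS.le_sum_inter hB (hS.sub j) (Finset.disjoint_right.1 (hS.disj j i hj) hB)
  by_contra h
  have h2 : ∑ m ∈ K.M B, (m ∩ S j).card < ∑ m ∈ K.M B, 1 :=
    Finset.sum_lt_sum (fun m hm => hS.inter_le hB hm j)
      ⟨m, hm, lt_of_le_of_ne (hS.inter_le hB hm j) h⟩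
  have h4 := hS.card j
  simp only [Finset.sum_const, smul_eq_mul, mul_one, hS.card_used hB] at h2
  omega

theorem IsCubic.two_le_card (hS : K.IsCubic S) {i : Fin 3} {B : α} (hB : B ∈ S i)
    {m : Finset α} (hm : m ∈ K.M B) : 2 ≤ m.card := by
  have h := hS.card_eq (K.ln_sub (K.M_ln (hS.sub i hB) hm))
  have h0 := fun j (hj : j ≠ i) => hS.inter_eq_one hj hB hm
  fin_cases i
  · have := h0 1 (by decide); have := h0 2 (by decide); omega
  · have := h0 0 (by decide); have := h0 2 (by decide); omega
  · have := h0 0 (by decide); have := h0 1 (by decide); omega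

theorem IsCubic.rk_outer (hS : K.IsCubic S) : K.rk 2 (K.outer S) = 0 := by
  have h1 := K.rk_mul (hS.ln 0) (subset_refl (K.outer S ∪ S 0)) 2
  have h2 := K.rk_mul (hS.ln 1) (subset_refl (K.outer S ∪ S 0 ∪ S 1)) 3
  have h3 := K.rk_mul (N := K.outer S ∪ S 0 ∪ S 1) (N' := K.X) (hS.ln 2) (by
    intro P hP
    by_cases h : P ∈ inner S
    · obtain ⟨i, hi⟩ := mem_inner.1 h
      fin_cases i <;> simp_all
    · simp [outer, hP, h]) 4
  have := K.rk_X
  simp only [Nat.reduceAdd] at h1 h2 h3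
  omega

theorem IsCubic.rk_outer_sdiff (hS : K.IsCubic S) {m : Finset α} (hm : K.IsLn m) :
    K.rk 1 (K.outer S \ m) = 0 := by
  have h := K.rk_mul (N := K.outer S \ m) (N' := K.outer S) hm
    (by rw [Finset.sdiff_union_self_eq_union]; exact Finset.subset_union_left) 1
  have := hS.rk_outer
  simp only [Nat.reduceAdd] at h
  omega

theorem exists_pair : ∀ i : Fin 3, ∃ j k, j ≠ i ∧ k ≠ i ∧ j ≠ k ∧ ∀ l, l = i ∨ l = j ∨ l = k := by
  decide

theorem mem_or_mem_outer {i j k : Fin 3}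
    (h : ∀ l, l = i ∨ l = j ∨ l = k) {P : α} (hP : P ∈ K.X) :
    P ∈ S i ∨ P ∈ S j ∨ P ∈ S k ∨ P ∈ K.outer S := by
  by_cases hPi : P ∈ inner S
  · obtain ⟨l, hl⟩ := mem_inner.1 hPi
    rcases h l with rfl | rfl | rfl <;> tauto
  · exact Or.inr (Or.inr (Or.inr (Finset.mem_sdiff.2 ⟨hP, hPi⟩)))

/-- A line used by a node of `S i` and missing `S i` is used by no other node of the three lines. -/
theorem IsCubic.unique_user (hS : K.IsCubic S) {i : Fin 3} {m : Finset α} {B C : α}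
    (hB : B ∈ S i) (hBm : m ∈ K.M B) (hm : m ∩ S i = ∅) (hC : C ∈ inner S) (hCm : m ∈ K.M C) :
    C = B := by
  by_contra hne
  obtain ⟨i', hC'⟩ := mem_inner.1 hC
  obtain rfl : i' = i := by
    by_contra h
    have := hS.inter_eq_one (Ne.symm h) hC' hCm
    simp [hm] at this
  obtain ⟨j, k, hj, hk, hjk, hall⟩ := exists_pair i'
  have hml := K.M_ln (hS.sub _ hB) hBm
  have hU : ({B, C} : Finset α) ⊆ K.X := by
    intro P; simp only [Finset.mem_insert, Finset.mem_singleton]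
    rintro (rfl | rfl)
    exacts [hS.sub _ hB, hS.sub _ hC']
  have h0 := K.rk_users hU (hS.two_le_card hB hBm) (by simp [hBm, hCm])
  rw [Finset.card_pair (Ne.symm hne)] at h0
  set N := (K.X \ m) \ {B, C} with hN
  have key : ∀ l, l ≠ i' → N ∩ S l = S l \ m := by
    intro l hl
    ext P
    simp only [hN, Finset.mem_inter, Finset.mem_sdiff, Finset.mem_insert, Finset.mem_singleton]
    have : P ∈ S l → P ∉ S i' := fun h => Finset.disjoint_left.1 (hS.disj l i' hl) h
    have : P ∈ S l → P ∈ K.X := fun h => hS.sub l h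
    constructor
    · tauto
    · rintro ⟨h1, h2⟩
      refine ⟨⟨⟨this h1, h2⟩, ?_⟩, h1⟩
      rintro (rfl | rfl) <;> tauto
  have card : ∀ l, l ≠ i' → (S l \ m).card = 4 := by
    intro l hl
    have h1 := Finset.card_inter_add_card_sdiff (S l) m
    rw [Finset.inter_comm, hS.inter_eq_one hl hB hBm, hS.card l] at h1
    omega
  have h1 := K.rk_step (hS.ln j) 3 N
  rw [key j hj, card j hj] at h1
  have h2 := K.rk_step (hS.ln k) 2 (N \ S j)
  have e2 : (N \ S j) ∩ S k = S k \ m := by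
    rw [← key k hk]
    ext P
    have : P ∈ S k → P ∉ S j := fun h => Finset.disjoint_left.1 (hS.disj k j hjk.symm) h
    simp only [Finset.mem_inter, Finset.mem_sdiff]; tauto
  rw [e2, card k hk] at h2
  have h3 := K.rk_step (hS.ln i') 1 ((N \ S j) \ S k)
  have e3 : ((N \ S j) \ S k) ∩ S i' = S i' \ {B, C} := by
    ext P
    have a1 : P ∈ S i' → P ∉ S j := fun h => Finset.disjoint_right.1 (hS.disj j i' hj) h
    have a2 : P ∈ S i' → P ∉ S k := fun h => Finset.disjoint_right.1 (hS.disj k i' hk) h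
    have a3 : P ∈ S i' → P ∉ m := fun h h' => by
      have : P ∈ m ∩ S i' := Finset.mem_inter.2 ⟨h', h⟩
      simp [hm] at this
    have a4 : P ∈ S i' → P ∈ K.X := fun h => hS.sub i' h
    simp only [hN, Finset.mem_inter, Finset.mem_sdiff]; tauto
  have c3 : (S i' \ {B, C}).card = 3 := by
    rw [Finset.card_sdiff_of_subset, hS.card, Finset.card_pair (Ne.symm hne)]
    intro P; simp only [Finset.mem_insert, Finset.mem_singleton]
    rintro (rfl | rfl) <;> assumption
  rw [e3, c3] at h3
  have e4 : ((N \ S j) \ S k) \ S i' = K.outer S \ m := by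
    ext P
    have a1 : P ∈ K.X → P ∈ S i' ∨ P ∈ S j ∨ P ∈ S k ∨ P ∈ K.outer S := mem_or_mem_outer hall
    have a2 : P ∈ K.outer S → P ∈ K.X ∧ P ∉ inner S := Finset.mem_sdiff.1
    rw [mem_inner] at a2
    simp only [hN, Finset.mem_sdiff, Finset.mem_insert, Finset.mem_singleton]
    constructor
    · tauto
    · rintro ⟨h1, h2⟩
      obtain ⟨b1, b2⟩ := a2 h1
      push Not at b2
      exact ⟨⟨⟨⟨⟨b1, h2⟩, by rintro (rfl | rfl) <;> exact b2 _ ‹_›⟩, b2 _⟩, b2 _⟩, b2 _⟩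
  have h4 := hS.rk_outer_sdiff hml
  rw [e4, h4] at h3
  simp only [Nat.reduceAdd] at h1 h2 h3
  omega

/-- Greedy covering of the nodes off a used line `m` that do not use `m` by the other four lines
used by `B`, together with the resulting bound on the number of nodes using `m`. -/
theorem exists_greedy {U : Finset α} {m : Finset α} {B : α} (hU : U ⊆ K.X) (hm : 2 ≤ m.card)
    (hu : ∀ C ∈ U, m ∈ K.M C) (hB : B ∈ U) (hc : (K.M B).card = 5) :
    ∃ N a b c d, N = (K.X \ m) \ U ∧ a ∈ K.M B ∧ b ∈ K.M B ∧ c ∈ K.M B ∧ d ∈ K.M B ∧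
      m.card + U.card + N.card = 21 ∧
      ((N \ a) ∩ b).card ≤ (N ∩ a).card ∧
      (((N \ a) \ b) ∩ c).card ≤ ((N \ a) ∩ b).card ∧
      ((((N \ a) \ b) \ c) ∩ d).card ≤ (((N \ a) \ b) ∩ c).card ∧
      (N ∩ a).card + ((N \ a) ∩ b).card + (((N \ a) \ b) ∩ c).card +
        ((((N \ a) \ b) \ c) ∩ d).card = N.card ∧
      U.card ≤ (5 - (N ∩ a).card) + (4 - ((N \ a) ∩ b).card) + (3 - (((N \ a) \ b) ∩ c).card) +
        (2 - ((((N \ a) \ b) \ c) ∩ d).card) + 1 := by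
  set N := (K.X \ m) \ U with hN
  have hBX := hU hB
  have step : ∀ (A : Finset (Finset α)) (R : Finset α) (n : ℕ), A.card = n + 1 →
      ∃ a ∈ A, (A.erase a).card = n ∧ ∀ b ∈ A.erase a, (R ∩ b).card ≤ (R ∩ a).card := by
    intro A R n hA
    obtain ⟨a, ha, hmax⟩ := Finset.exists_max_image A (fun b => (R ∩ b).card)
      (Finset.card_pos.1 (by omega))
    exact ⟨a, ha, by rw [Finset.card_erase_of_mem ha]; omega,
      fun b hb => hmax b (Finset.mem_of_mem_erase hb)⟩
  obtain ⟨a, ha, ca, ma⟩ := step ((K.M B).erase m) N 3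
    (by rw [Finset.card_erase_of_mem (hu B hB)]; omega)
  obtain ⟨b, hb, cb, mb⟩ := step _ (N \ a) 2 ca
  obtain ⟨c, hc', cc, mc⟩ := step _ ((N \ a) \ b) 1 cb
  obtain ⟨d, hd, cd, md⟩ := step _ (((N \ a) \ b) \ c) 0 cc
  have hbb := Finset.mem_of_mem_erase hb
  have hcc := Finset.mem_of_mem_erase hc'
  have hcc' := Finset.mem_of_mem_erase hcc
  have hdd := Finset.mem_of_mem_erase hd
  have hdd' := Finset.mem_of_mem_erase hdd
  have hdd'' := Finset.mem_of_mem_erase hdd'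
  have hcov : (((N \ a) \ b) \ c) \ d = ∅ := by
    by_contra hne
    obtain ⟨P, hP⟩ := Finset.nonempty_iff_ne_empty.2 hne
    simp only [hN, Finset.mem_sdiff] at hP
    obtain ⟨⟨⟨⟨⟨⟨hPX, hPm⟩, hPU⟩, hPa⟩, hPb⟩, hPc⟩, hPd⟩ := hP
    obtain ⟨t, ht, hPt⟩ := K.M_cover hBX hPX (fun h => hPU (h ▸ hB))
    have : t ∈ ((((((K.M B).erase m).erase a).erase b).erase c).erase d) := by
      simp only [Finset.mem_erase]
      refine ⟨?_, ?_, ?_, ?_, ?_, ht⟩ <;> rintro rfl <;> contradiction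
    rw [Finset.card_eq_zero.1 cd] at this
    simp at this
  have la := K.M_ln hBX (Finset.mem_of_mem_erase ha)
  have lb := K.M_ln hBX (Finset.mem_of_mem_erase hbb)
  have lc := K.M_ln hBX (Finset.mem_of_mem_erase hcc')
  have ld := K.M_ln hBX (Finset.mem_of_mem_erase hdd'')
  have lm := K.M_ln hBX (hu B hB)
  refine ⟨N, a, b, c, d, rfl, Finset.mem_of_mem_erase ha, Finset.mem_of_mem_erase hbb,
    Finset.mem_of_mem_erase hcc', Finset.mem_of_mem_erase hdd'', ?_, ?_, ?_, ?_, ?_, ?_⟩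
  · have hUm : U ⊆ K.X \ m := fun C hC =>
      Finset.mem_sdiff.2 ⟨hU hC, K.M_not_mem (hU hC) (hu C hC)⟩
    have h1 := Finset.card_sdiff_of_subset hUm
    rw [← hN] at h1
    have h2 := Finset.card_sdiff_of_subset (K.ln_sub lm)
    have h3 := Finset.card_le_card hUm
    have h4 := Finset.card_le_card (K.ln_sub lm)
    rw [K.card_X] at h2 h4
    omega
  · exact (Finset.card_le_card (Finset.inter_subset_inter_right Finset.sdiff_subset)).trans
      (ma b hb)
  · exact (Finset.card_le_card (Finset.inter_subset_inter_right Finset.sdiff_subset)).trans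
      (mb c hc')
  · exact (Finset.card_le_card (Finset.inter_subset_inter_right Finset.sdiff_subset)).trans
      (mc d hd)
  · have h1 := Finset.card_inter_add_card_sdiff N a
    have h2 := Finset.card_inter_add_card_sdiff (N \ a) b
    have h3 := Finset.card_inter_add_card_sdiff ((N \ a) \ b) c
    have h4 := Finset.card_inter_add_card_sdiff (((N \ a) \ b) \ c) d
    rw [hcov, Finset.card_empty] at h4
    omega
  · have h0 := K.rk_users hU hm hu
    rw [← hN] at h0
    have h1 := K.rk_step la 3 N
    have h2 := K.rk_step lb 2 (N \ a)
    have h3 := K.rk_step lc 1 ((N \ a) \ b)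
    have h4 := K.rk_step ld 0 (((N \ a) \ b) \ c)
    have h5 := K.rk_zero ((((N \ a) \ b) \ c) \ d)
    simp only [Nat.reduceAdd] at h1 h2 h3 h4
    omega

theorem isCubic_of_disjoint {a b c : Finset α} (ha : K.IsLn a) (hb : K.IsLn b) (hc : K.IsLn c)
    (ca : a.card = 5) (cb : b.card = 5) (cc : c.card = 5) (hab : Disjoint a b) (hac : Disjoint a c)
    (hbc : Disjoint b c) : K.IsCubic ![a, b, c] := by
  refine ⟨?_, ?_, ?_⟩
  · intro i; fin_cases i <;> assumption
  · intro i; fin_cases i <;> assumption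
  · intro i j
    fin_cases i <;> fin_cases j <;> simp [hab, hac, hbc, hab.symm, hac.symm, hbc.symm]

theorem subset_of_five_le {N a : Finset α} (ha : K.IsLn a) (h : 5 ≤ (N ∩ a).card) :
    a ⊆ N ∧ a.card = 5 := by
  have h1 := K.ln_card ha
  have h2 := Finset.card_le_card (Finset.inter_subset_right : N ∩ a ⊆ a)
  exact ⟨Finset.inter_eq_right.1 (Finset.eq_of_subset_of_card_le Finset.inter_subset_right
    (by omega)), by omega⟩

theorem card_inter_le_five {N a : Finset α} (ha : K.IsLn a) : (N ∩ a).card ≤ 5 :=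
  (Finset.card_le_card Finset.inter_subset_right).trans (K.ln_card ha)

theorem IsCubic.card_used_inner (hS : K.IsCubic S) {B : α} (hB : B ∈ inner S) :
    (K.M B).card = 5 := by
  obtain ⟨i, hi⟩ := mem_inner.1 hB
  exact hS.card_used hi

theorem forall_fin_three_mem {β : Type*} {s : Finset β} {a b c : β} (ha : a ∈ s) (hb : b ∈ s)
    (hc : c ∈ s) (i : Fin 3) : ![a, b, c] i ∈ s := by
  fin_cases i <;> assumption

theorem IsCubic.exists_isCubic_of_five (hS : K.IsCubic S) {U m : Finset α} {B : α}
    (hU : U ⊆ inner S) (cU : U.card = 5) (cm : m.card = 5) (hu : ∀ C ∈ U, m ∈ K.M C)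
    (hB : B ∈ U) : ∃ d, K.IsCubic d ∧ ∀ i, d i ∈ K.M B := by
  have hBX := hS.inner_sub (hU hB)
  obtain ⟨N, a, b, c, d, hN, ha, hb, hc, hd, h1, h2, h3, h4, h5, h6⟩ :=
    exists_greedy (hU.trans hS.inner_sub) (by omega) hu hB (hS.card_used_inner (hU hB))
  have la := K.M_ln hBX ha
  have lb := K.M_ln hBX hb
  have h7 := card_inter_le_five (N := N) la
  obtain ⟨sa, ca⟩ := subset_of_five_le (N := N) la (by omega)
  obtain ⟨sb, cb⟩ := subset_of_five_le (N := N \ a) lb (by omega)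
  have hNm : Disjoint m N := hN ▸ (Finset.disjoint_sdiff.mono_right Finset.sdiff_subset)
  refine ⟨![m, a, b], isCubic_of_disjoint (K.M_ln hBX (hu B hB)) la lb cm ca cb
    (hNm.mono_right sa) (hNm.mono_right (sb.trans Finset.sdiff_subset))
    (Finset.disjoint_sdiff.mono_right sb), forall_fin_three_mem (hu B hB) ha hb⟩

theorem IsCubic.exists_isCubic_of_three (hS : K.IsCubic S) {U m : Finset α} {B : α}
    (hU : U ⊆ inner S) (cU : U.card = 3) (cm : m.card = 3) (hu : ∀ C ∈ U, m ∈ K.M C)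
    (hB : B ∈ U) : ∃ d, K.IsCubic d ∧ ∀ i, d i ∈ K.M B := by
  have hBX := hS.inner_sub (hU hB)
  obtain ⟨N, a, b, c, d, hN, ha, hb, hc, hd, h1, h2, h3, h4, h5, h6⟩ :=
    exists_greedy (hU.trans hS.inner_sub) (by omega) hu hB (hS.card_used_inner (hU hB))
  have la := K.M_ln hBX ha
  have lb := K.M_ln hBX hb
  have lc := K.M_ln hBX hc
  have h7 := card_inter_le_five (N := N) la
  obtain ⟨sa, ca⟩ := subset_of_five_le (N := N) la (by omega)
  obtain ⟨sb, cb⟩ := subset_of_five_le (N := N \ a) lb (by omega)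
  obtain ⟨sc, cc⟩ := subset_of_five_le (N := (N \ a) \ b) lc (by omega)
  exact ⟨![a, b, c], isCubic_of_disjoint la lb lc ca cb cc (Finset.disjoint_sdiff.mono_right sb)
    (Finset.disjoint_sdiff.mono_right (sc.trans Finset.sdiff_subset))
    (Finset.disjoint_sdiff.mono_right sc), forall_fin_three_mem ha hb hc⟩

theorem IsCubic.not_four_users (hS : K.IsCubic S) {U m : Finset α} (hU : U ⊆ inner S)
    (cU : U.card = 4) (cm : m.card = 4) (hu : ∀ C ∈ U, m ∈ K.M C) : False := by
  obtain ⟨B, hB⟩ := Finset.card_pos.1 (by omega : 0 < U.card)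
  have hBX := hS.inner_sub (hU hB)
  obtain ⟨N, a, b, c, d, hN, ha, hb, hc, hd, h1, h2, h3, h4, h5, h6⟩ :=
    exists_greedy (hU.trans hS.inner_sub) (by omega) hu hB (hS.card_used_inner (hU hB))
  have h7 := card_inter_le_five (N := N) (K.M_ln hBX ha)
  omega

/-- If three nodes use a line through four nodes, they share four used lines, two of which
contain five nodes. -/
theorem IsCubic.exists_shared (hS : K.IsCubic S) {U m : Finset α} (hU : U ⊆ inner S)
    (cU : U.card = 3) (cm : m.card = 4) (hu : ∀ C ∈ U, m ∈ K.M C) :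
    ∃ a b c, a ≠ b ∧ a.card = 5 ∧ b.card = 5 ∧ ({m, a, b, c} : Finset (Finset α)).card = 4 ∧
      ∀ C ∈ U, {m, a, b, c} ⊆ K.M C := by
  obtain ⟨B, hB⟩ := Finset.card_pos.1 (by omega : 0 < U.card)
  have hBX := hS.inner_sub (hU hB)
  obtain ⟨N, a, b, c, d, hN, ha, hb, hc, hd, h1, h2, h3, h4, h5, h6⟩ :=
    exists_greedy (hU.trans hS.inner_sub) (by omega) hu hB (hS.card_used_inner (hU hB))
  have la := K.M_ln hBX ha
  have lb := K.M_ln hBX hb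
  have lc := K.M_ln hBX hc
  have h7 := card_inter_le_five (N := N) la
  obtain ⟨sa, ca⟩ := subset_of_five_le (N := N) la (by omega)
  obtain ⟨sb, cb⟩ := subset_of_five_le (N := N \ a) lb (by omega)
  set R := ((N \ a) \ b) ∩ c with hR
  have cR : R.card = 4 := by omega
  have hNm : Disjoint m N := hN ▸ (Finset.disjoint_sdiff.mono_right Finset.sdiff_subset)
  have hNU : ∀ C ∈ U, C ∉ N := fun C hC h => by
    rw [hN, Finset.mem_sdiff] at h; exact h.2 hC
  have hma := hNm.mono_right sa
  have hmb := hNm.mono_right (sb.trans Finset.sdiff_subset)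
  have hab : Disjoint a b := Finset.disjoint_sdiff.mono_right sb
  have hRN : R ⊆ N := Finset.inter_subset_left.trans (Finset.sdiff_subset.trans Finset.sdiff_subset)
  have hmR := hNm.mono_right hRN
  have haR : Disjoint a R := Finset.disjoint_sdiff.mono_right
    (Finset.inter_subset_left.trans Finset.sdiff_subset)
  have hbR : Disjoint b R := Finset.disjoint_sdiff.mono_right Finset.inter_subset_left
  have hRc : R ⊆ c := Finset.inter_subset_right
  have ne : ∀ {s t : Finset α}, 0 < t.card → Disjoint s t → s ≠ t := by
    rintro s t ht h rfl
    rw [disjoint_self] at h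
    simp [h] at ht
  have neR : ∀ {s : Finset α}, Disjoint s R → s ≠ c := by
    rintro s h rfl
    exact ne (by omega) (h.mono_left hRc) rfl
  have nma : m ≠ a := ne (by omega) hma
  have nmb : m ≠ b := ne (by omega) hmb
  have nab : a ≠ b := ne (by omega) hab
  have nmc := neR hmR
  have nac := neR haR
  have nbc := neR hbR
  refine ⟨a, b, c, nab, ca, cb, ?_, fun C hC => ?_⟩
  · rw [Finset.card_insert_of_notMem, Finset.card_insert_of_notMem, Finset.card_pair nbc] <;>
      simp [*]
  · have hCX := hS.inner_sub (hU hC)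
    have uma : a ∈ K.M C := mem_used_of_card_lt hCX la (T := {m}) (by simpa using hu C hC)
      subset_rfl (fun h => hNU C hC (sa h)) (by simpa using hma) (by simp [ca])
    have umb : b ∈ K.M C := mem_used_of_card_lt hCX lb (T := {m}) (by simpa using hu C hC)
      subset_rfl (fun h => hNU C hC (Finset.mem_sdiff.1 (sb h)).1) (by simpa using hmb)
      (by simp [cb])
    have hT : ({m, a, b} : Finset (Finset α)) ⊆ K.M C := by
      simp [Finset.insert_subset_iff, hu C hC, uma, umb]
    have umc : c ∈ K.M C := mem_used_of_card_lt hCX lc hT hRc (fun h => hNU C hC (hRN h))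
      (by simp [hmR, haR, hbR]) (by
        rw [cR, Finset.card_insert_of_notMem, Finset.card_pair nab] <;> simp [*])
    simp [Finset.insert_subset_iff, hu C hC, uma, umb, umc]

theorem IsCubic.mem_used_of_outer (hS : K.IsCubic S) {G : α} (hG : G ∈ K.outer S) (i : Fin 3) :
    S i ∈ K.M G := by
  obtain ⟨hGX, hGS⟩ := Finset.mem_sdiff.1 hG
  have h : ∀ l, G ∉ S l := fun l hl => hGS (mem_inner.2 ⟨l, hl⟩)
  obtain ⟨j, k, hj, hk, hjk, -⟩ := exists_pair i
  exact K.cubic_used (hS.ln i) (hS.ln j) (hS.ln k) (hS.card i) (hS.card j) (hS.card k)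
    (hS.disj i j hj.symm) (hS.disj i k hk.symm) (hS.disj j k hjk) hGX (h i) (h j) (h k)

theorem IsCubic.injective (hS : K.IsCubic S) : Function.Injective S := by
  intro i j h
  by_contra hij
  have := hS.disj i j hij
  rw [h, disjoint_self] at this
  have h2 := hS.card j
  simp [this] at h2

theorem IsCubic.exists_two_lines (hS : K.IsCubic S) {G : α} (hG : G ∈ K.outer S) :
    ∃ a b, K.IsLn a ∧ K.IsLn b ∧ G ∉ a ∧ G ∉ b ∧ ∀ P ∈ K.outer S, P ≠ G → P ∈ a ∨ P ∈ b := by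
  have hGX := (Finset.mem_sdiff.1 hG).1
  set A := K.M G \ Finset.univ.image S with hA
  have hsub : Finset.univ.image S ⊆ K.M G := by
    intro m; simp only [Finset.mem_image, Finset.mem_univ, true_and]
    rintro ⟨i, rfl⟩; exact hS.mem_used_of_outer hG i
  have hcA : A.card ≤ 2 := by
    have h := K.M_card hGX
    rw [hA, Finset.card_sdiff_of_subset hsub, Finset.card_image_of_injective _ hS.injective]
    simp; omega
  have hcov : ∀ P ∈ K.outer S, P ≠ G → ∃ a ∈ A, P ∈ a := by
    intro P hP hPG
    obtain ⟨hPX, hPS⟩ := Finset.mem_sdiff.1 hP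
    obtain ⟨m, hm, hPm⟩ := K.M_cover hGX hPX hPG
    refine ⟨m, Finset.mem_sdiff.2 ⟨hm, ?_⟩, hPm⟩
    simp only [Finset.mem_image, Finset.mem_univ, true_and]
    rintro ⟨i, rfl⟩
    exact hPS (mem_inner.2 ⟨i, hPm⟩)
  obtain ⟨P, hP, hPG⟩ := Finset.exists_mem_ne (by rw [hS.card_outer]; norm_num) G
  obtain ⟨a, ha, -⟩ := hcov P hP hPG
  have hu : ∀ m ∈ A, m ∈ K.M G := fun m hm => (Finset.mem_sdiff.1 hm).1
  obtain ⟨b, hb, hab⟩ : ∃ b ∈ A, ∀ m ∈ A, m = a ∨ m = b := by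
    by_cases h : ∃ b ∈ A, b ≠ a
    · obtain ⟨b, hb, hba⟩ := h
      refine ⟨b, hb, fun m hm => ?_⟩
      by_contra! hne
      have : ({m, a, b} : Finset (Finset α)) ⊆ A := by
        simp [Finset.insert_subset_iff, ha, hb, hm]
      have := Finset.card_le_card this
      rw [Finset.card_insert_of_notMem (by simp [hne]), Finset.card_pair hba.symm] at this
      omega
    · push Not at h
      exact ⟨a, ha, fun m hm => Or.inl (h m hm)⟩
  refine ⟨a, b, K.M_ln hGX (hu a ha), K.M_ln hGX (hu b hb), K.M_not_mem hGX (hu a ha),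
    K.M_not_mem hGX (hu b hb), fun P hP hPG => ?_⟩
  obtain ⟨m, hm, hPm⟩ := hcov P hP hPG
  rcases hab m hm with rfl | rfl
  exacts [Or.inl hPm, Or.inr hPm]

theorem IsCubic.not_outer_subset (hS : K.IsCubic S) {a b : Finset α} (ha : K.IsLn a)
    (hb : K.IsLn b) : ¬ K.outer S ⊆ a ∪ b := by
  intro h
  have h1 := K.rk_mul (N := ∅) (N' := b) hb (by simp) 0
  have h2 := K.rk_mul (N := b) (N' := K.outer S) ha (by rwa [Finset.union_comm]) 1
  have h3 := hS.rk_outer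
  have h4 := K.rk_pos
  simp only [Nat.reduceAdd] at h1 h2
  omega

theorem IsCubic.inter_outer_le (hS : K.IsCubic S) {m : Finset α} (hm : K.IsLn m) :
    (m ∩ K.outer S).card ≤ 3 := by
  by_contra! h
  obtain ⟨G, hG⟩ := Finset.card_pos.1 (by omega : 0 < (m ∩ K.outer S).card)
  obtain ⟨hGm, hGY⟩ := Finset.mem_inter.1 hG
  obtain ⟨a, b, ha, hb, hGa, hGb, hcov⟩ := hS.exists_two_lines hGY
  have h1 : (m ∩ K.outer S).erase G ⊆ (m ∩ a) ∪ (m ∩ b) := by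
    intro P hP
    obtain ⟨hPG, hP⟩ := Finset.mem_erase.1 hP
    obtain ⟨hPm, hPY⟩ := Finset.mem_inter.1 hP
    rcases hcov P hPY hPG with h | h <;> simp [hPm, h]
  have h2 := (Finset.card_le_card h1).trans (Finset.card_union_le _ _)
  have h3 := inter_card_le hm ha (by rintro rfl; exact hGa hGm)
  have h4 := inter_card_le hm hb (by rintro rfl; exact hGb hGm)
  rw [Finset.card_erase_of_mem hG] at h2
  omega

theorem IsCubic.exists_three_line (hS : K.IsCubic S) {G : α} (hG : G ∈ K.outer S) :
    ∃ a, K.IsLn a ∧ G ∉ a ∧ (a ∩ K.outer S).card = 3 := by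
  obtain ⟨a, b, ha, hb, hGa, hGb, hcov⟩ := hS.exists_two_lines hG
  have h1 : (K.outer S).erase G ⊆ (a ∩ K.outer S) ∪ (b ∩ K.outer S) := by
    intro P hP
    obtain ⟨hPG, hPY⟩ := Finset.mem_erase.1 hP
    rcases hcov P hPY hPG with h | h <;> simp [hPY, h]
  have h2 := (Finset.card_le_card h1).trans (Finset.card_union_le _ _)
  rw [Finset.card_erase_of_mem hG, hS.card_outer] at h2
  have h3 := hS.inter_outer_le ha
  have h4 := hS.inter_outer_le hb
  by_cases h : (a ∩ K.outer S).card = 3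
  · exact ⟨a, ha, hGa, h⟩
  · exact ⟨b, hb, hGb, by omega⟩

theorem IsCubic.three_lines_meet (hS : K.IsCubic S) {a b : Finset α} (ha : K.IsLn a)
    (hb : K.IsLn b) (ca : (a ∩ K.outer S).card = 3) (cb : (b ∩ K.outer S).card = 3) :
    ∃ P ∈ K.outer S, P ∈ a ∧ P ∈ b := by
  by_contra! h
  have hd : Disjoint (a ∩ K.outer S) (b ∩ K.outer S) := by
    rw [Finset.disjoint_left]
    simp only [Finset.mem_inter]
    rintro P ⟨h1, h2⟩ ⟨h3, -⟩
    exact h P h2 h1 h3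
  have h1 : (a ∩ K.outer S) ∪ (b ∩ K.outer S) = K.outer S := by
    refine Finset.eq_of_subset_of_card_le
      (Finset.union_subset Finset.inter_subset_right Finset.inter_subset_right) ?_
    rw [Finset.card_union_of_disjoint hd, hS.card_outer]; omega
  refine hS.not_outer_subset ha hb ?_
  rw [← Finset.union_inter_distrib_right] at h1
  exact Finset.inter_eq_right.1 h1

/-- The six nodes off the three lines are the vertices `v i` of a triangle with sides `e i` and one
further node `w i` on each side. -/
structure IsTriangle (K : LineConfig α) (S : Fin 3 → Finset α) (v w : Fin 3 → α)
    (e : Fin 3 → Finset α) : Prop where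
  ln : ∀ i, K.IsLn (e i)
  card : ∀ i, (e i ∩ K.outer S).card = 3
  inj : Function.Injective e
  v_mem : ∀ i j, i ≠ j → v j ∈ e i
  w_mem : ∀ i, w i ∈ e i
  v_outer : ∀ i, v i ∈ K.outer S
  w_outer : ∀ i, w i ∈ K.outer S
  cover : ∀ P ∈ K.outer S, ∃ i, P = v i ∨ P = w i

theorem IsCubic.exists_isTriangle (hS : K.IsCubic S) : ∃ v w e, IsTriangle K S v w e := by
  obtain ⟨G, hG⟩ := Finset.card_pos.1 (by rw [hS.card_outer]; norm_num : 0 < (K.outer S).card)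
  obtain ⟨a, ha, -, ca⟩ := hS.exists_three_line hG
  obtain ⟨p, hp⟩ := Finset.card_pos.1 (by omega : 0 < (a ∩ K.outer S).card)
  obtain ⟨hpa, hpY⟩ := Finset.mem_inter.1 hp
  obtain ⟨b, hb, hpb, cb⟩ := hS.exists_three_line hpY
  have hab : a ≠ b := by rintro rfl; exact hpb hpa
  obtain ⟨r, hrY, hra, hrb⟩ := hS.three_lines_meet ha hb ca cb
  obtain ⟨c, hc, hrc, cc⟩ := hS.exists_three_line hrY
  have hac : a ≠ c := by rintro rfl; exact hrc hra
  have hbc : b ≠ c := by rintro rfl; exact hrc hrb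
  obtain ⟨q, hqY, hqa, hqc⟩ := hS.three_lines_meet ha hc ca cc
  obtain ⟨s, hsY, hsb, hsc⟩ := hS.three_lines_meet hb hc cb cc
  have hrq : r ≠ q := by rintro rfl; exact hrc hqc
  have hrs : r ≠ s := by rintro rfl; exact hrc hsc
  have hqs : q ≠ s := by
    rintro rfl
    exact hab (K.ln_eq ha hb hrq hra hqa hrb hsb)
  have third : ∀ {m x y}, (m ∩ K.outer S).card = 3 → x ≠ y → x ∈ m → y ∈ m → x ∈ K.outer S →
      y ∈ K.outer S → ∃ z ∈ K.outer S, z ∈ m ∧ z ≠ x ∧ z ≠ y := by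
    intro m x y h hxy hx hy hxY hyY
    have h1 : ({x, y} : Finset α) ⊆ m ∩ K.outer S := by
      simp [Finset.insert_subset_iff, *]
    have h2 := Finset.card_sdiff_of_subset h1
    rw [h, Finset.card_pair hxy] at h2
    obtain ⟨z, hz⟩ := Finset.card_pos.1 (by omega : 0 < ((m ∩ K.outer S) \ {x, y}).card)
    simp only [Finset.mem_sdiff, Finset.mem_inter, Finset.mem_insert, Finset.mem_singleton,
      not_or] at hz
    exact ⟨z, hz.1.2, hz.1.1, hz.2⟩
  obtain ⟨x, hxY, hxa, hxr, hxq⟩ := third ca hrq hra hqa hrY hqY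
  obtain ⟨y, hyY, hyb, hyr, hys⟩ := third cb hrs hrb hsb hrY hsY
  obtain ⟨z, hzY, hzc, hzq, hzs⟩ := third cc hqs hqc hsc hqY hsY
  have hxb : x ∉ b := fun h => hab (K.ln_eq ha hb hxr hxa hra h hrb)
  have hxc : x ∉ c := fun h => hac (K.ln_eq ha hc hxq hxa hqa h hqc)
  have hyc : y ∉ c := fun h => hbc (K.ln_eq hb hc hys hyb hsb h hsc)
  have hqb : q ∉ b := fun h => hab (K.ln_eq ha hb hrq hra hqa hrb h)
  have hxs : x ≠ s := by rintro rfl; exact hxb hsb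
  have hyq : y ≠ q := by rintro rfl; exact hqb hyb
  have hxy : x ≠ y := by rintro rfl; exact hxb hyb
  have hxz : x ≠ z := by rintro rfl; exact hxc hzc
  have hyz : y ≠ z := by rintro rfl; exact hyc hzc
  have hzr : z ≠ r := by rintro rfl; exact hrc hzc
  have hY : K.outer S = {r, q, s, x, y, z} := by
    symm
    refine Finset.eq_of_subset_of_card_le ?_ ?_
    · simp [Finset.insert_subset_iff, *]
    · rw [hS.card_outer, Finset.card_insert_of_notMem, Finset.card_insert_of_notMem,
        Finset.card_insert_of_notMem, Finset.card_insert_of_notMem, Finset.card_pair hyz] <;>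
        simp [*, hxr.symm, hyr.symm, hzr.symm, hxq.symm, hyq.symm, hzq.symm, hxs.symm, hys.symm,
          hzs.symm]
  refine ⟨![s, q, r], ![x, y, z], ![a, b, c], ?_, ?_, ?_, ?_, ?_, ?_, ?_, ?_⟩
  · intro i; fin_cases i <;> assumption
  · intro i; fin_cases i <;> assumption
  · intro i j; fin_cases i <;> fin_cases j <;> simp [hab, hac, hbc, hab.symm, hac.symm, hbc.symm]
  · intro i j; fin_cases i <;> fin_cases j <;> simp [*]
  · intro i; fin_cases i <;> assumption
  · intro i; fin_cases i <;> assumption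
  · intro i; fin_cases i <;> assumption
  · intro P hP
    rw [hY] at hP
    simp only [Finset.mem_insert, Finset.mem_singleton] at hP
    simp only [Fin.exists_fin_succ, Matrix.cons_val_zero, Matrix.cons_val_succ]
    simp
    tauto

instance (S : Fin 3 → Finset α) (m : Finset α) : Decidable (Transversal S m) :=
  inferInstanceAs (Decidable (∀ _, _))

theorem IsCubic.inter_eq_empty (hS : K.IsCubic S) {i : Fin 3} {B : α} (hB : B ∈ S i)
    {m : Finset α} (hm : m ∈ K.M B) (ht : ¬ Transversal S m) : m ∩ S i = ∅ := by
  by_contra hne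
  refine ht fun j => ?_
  by_cases hj : j = i
  · subst hj
    have := Finset.card_pos.2 (Finset.nonempty_iff_ne_empty.2 hne)
    have := hS.inter_le hB hm j
    omega
  · exact hS.inter_eq_one hj hB hm

theorem IsCubic.four_le_card_filter (hS : K.IsCubic S) {i : Fin 3} {B : α} (hB : B ∈ S i) :
    4 ≤ ((K.M B).filter (Transversal S)).card := by
  have h1 := hS.le_sum_inter hB (R := (S i).erase B)
    ((Finset.erase_subset _ _).trans (hS.sub i)) (Finset.notMem_erase _ _)
  rw [Finset.card_erase_of_mem hB, hS.card] at h1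
  refine h1.trans ?_
  rw [Finset.card_filter]
  refine Finset.sum_le_sum fun m hm => ?_
  have h2 : (m ∩ (S i).erase B).card ≤ (m ∩ S i).card :=
    Finset.card_le_card (Finset.inter_subset_inter_left (Finset.erase_subset _ _))
  split_ifs with ht
  · exact h2.trans (hS.inter_le hB hm i)
  · rwa [hS.inter_eq_empty hB hm ht, Finset.card_empty] at h2

theorem IsCubic.card_lines_le (hS : K.IsCubic S) {j k : Fin 3} (hjk : j ≠ k)
    {F : Finset (Finset α)} (hF : ∀ m ∈ F, K.IsLn m ∧ (m ∩ S j).card = 1 ∧ (m ∩ S k).card = 1) :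
    F.card ≤ 25 := by
  have h1 : (F.biUnion fun m => (m ∩ S j) ×ˢ (m ∩ S k)).card = F.card := by
    rw [Finset.card_biUnion, Finset.sum_congr rfl (g := fun _ => 1)]
    · simp
    · intro m hm
      rw [Finset.card_product, (hF m hm).2.1, (hF m hm).2.2]
    · intro m hm n hn hmn
      refine Finset.disjoint_left.2 ?_
      rintro ⟨P, Q⟩ h h'
      simp only [Finset.mem_product, Finset.mem_inter] at h h'
      refine hmn (K.ln_eq (hF m hm).1 (hF n hn).1 ?_ h.1.1 h.2.1 h'.1.1 h'.2.1)
      rintro rfl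
      exact Finset.disjoint_left.1 (hS.disj j k hjk) h.1.2 h.2.2
  have h2 : (F.biUnion fun m => (m ∩ S j) ×ˢ (m ∩ S k)) ⊆ S j ×ˢ S k :=
    Finset.biUnion_subset.2 fun m _ =>
      Finset.product_subset_product Finset.inter_subset_right Finset.inter_subset_right
  have h3 := Finset.card_le_card h2
  rw [h1, Finset.card_product, hS.card, hS.card] at h3
  exact h3

/-- The transversal lines used by some node on the three lines. -/
def transversals (K : LineConfig α) (S : Fin 3 → Finset α) : Finset (Finset α) :=
  ((inner S).biUnion K.M).filter (Transversal S)

/-- The nodes on the three lines that use `m`. -/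
def users (K : LineConfig α) (S : Fin 3 → Finset α) (m : Finset α) : Finset α :=
  (inner S).filter (fun B => m ∈ K.M B)

theorem mem_users {m : Finset α} {B : α} : B ∈ K.users S m ↔ B ∈ inner S ∧ m ∈ K.M B :=
  Finset.mem_filter

theorem mem_transversals {m : Finset α} :
    m ∈ K.transversals S ↔ (∃ B ∈ inner S, m ∈ K.M B) ∧ Transversal S m := by
  simp [transversals]

theorem IsCubic.ln_of_mem_transversals (hS : K.IsCubic S) {m : Finset α}
    (hm : m ∈ K.transversals S) : K.IsLn m := by
  obtain ⟨⟨B, hB, hm⟩, -⟩ := mem_transversals.1 hm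
  exact K.M_ln (hS.inner_sub hB) hm

theorem IsCubic.card_transversal (hS : K.IsCubic S) {m : Finset α} (hm : K.IsLn m)
    (ht : Transversal S m) : m.card = 3 + (m ∩ K.outer S).card := by
  have := hS.card_eq (K.ln_sub hm)
  rw [ht, ht, ht] at this
  omega

theorem IsCubic.card_transversals_le (hS : K.IsCubic S) (i : Fin 3) :
    (K.transversals S).card ≤ ∑ B ∈ S i, ((K.M B).filter (Transversal S)).card := by
  obtain ⟨j, k, hj, hk, hjk, -⟩ := exists_pair i
  set NT := (S i).biUnion fun B => (K.M B).filter (fun m => ¬ Transversal S m) with hNT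
  have h1 : NT.card = ∑ B ∈ S i, ((K.M B).filter (fun m => ¬ Transversal S m)).card := by
    refine Finset.card_biUnion fun B hB C hC hBC => ?_
    refine Finset.disjoint_left.2 fun m hm hm' => ?_
    rw [Finset.mem_filter] at hm hm'
    exact hBC (hS.unique_user hB hm.1 (hS.inter_eq_empty hB hm.1 hm.2)
      (mem_inner.2 ⟨i, hC⟩) hm'.1).symm
  have h2 : ∑ B ∈ S i, ((K.M B).filter (Transversal S)).card +
      ∑ B ∈ S i, ((K.M B).filter (fun m => ¬ Transversal S m)).card = 25 := by
    rw [← Finset.sum_add_distrib, Finset.sum_congr rfl (g := fun _ => 5)]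
    · simp [hS.card]
    · intro B hB
      rw [Finset.card_filter_add_card_filter_not, hS.card_used hB]
  have h3 : (K.transversals S ∪ NT).card ≤ 25 := by
    refine hS.card_lines_le hjk fun m hm => ?_
    rcases Finset.mem_union.1 hm with hm | hm
    · exact ⟨hS.ln_of_mem_transversals hm, (mem_transversals.1 hm).2 j,
        (mem_transversals.1 hm).2 k⟩
    · obtain ⟨B, hB, hm⟩ := Finset.mem_biUnion.1 hm
      have hm := (Finset.mem_filter.1 hm).1
      exact ⟨K.M_ln (hS.sub i hB) hm, hS.inter_eq_one hj hB hm, hS.inter_eq_one hk hB hm⟩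
  rw [Finset.card_union_of_disjoint] at h3
  · omega
  · rw [Finset.disjoint_left]
    intro m hm hm'
    obtain ⟨B, -, hm'⟩ := Finset.mem_biUnion.1 hm'
    exact (Finset.mem_filter.1 hm').2 (mem_transversals.1 hm).2

theorem IsCubic.sum_users (hS : K.IsCubic S) :
    ∑ m ∈ K.transversals S, (K.users S m).card =
      ∑ i, ∑ B ∈ S i, ((K.M B).filter (Transversal S)).card := by
  have h1 := Finset.sum_card_bipartiteAbove_eq_sum_card_bipartiteBelow
    (s := K.transversals S) (t := inner S) (fun m B => m ∈ K.M B)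
  have h2 : ∑ B ∈ inner S, ((K.M B).filter (Transversal S)).card =
      ∑ i, ∑ B ∈ S i, ((K.M B).filter (Transversal S)).card := by
    rw [inner, Finset.sum_biUnion]
    exact fun i _ j _ hij => hS.disj i j hij
  rw [← h2]
  refine h1.trans (Finset.sum_congr rfl fun B hB => ?_)
  congr 1
  ext m
  simp only [Finset.mem_bipartiteBelow, Finset.mem_filter, mem_transversals]
  exact ⟨fun h => ⟨h.2, h.1.2⟩, fun h => ⟨⟨⟨B, hB, h.1⟩, h.2⟩, h.1⟩⟩

theorem IsCubic.card_two_le (hS : K.IsCubic S) {D : Finset (Finset α)}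
    (hD : ∀ m ∈ D, K.IsLn m ∧ (m ∩ K.outer S).card = 2) : D.card ≤ 6 := by
  obtain ⟨v, w, e, he⟩ := hS.exists_isTriangle
  set Y := K.outer S with hY
  have hdis : ∀ {a b : Finset α}, K.IsLn a → K.IsLn b → a ≠ b →
      Disjoint ((a ∩ Y).powersetCard 2) ((b ∩ Y).powersetCard 2) := by
    intro a b ha hb hab
    rw [Finset.disjoint_left]
    intro p h h'
    rw [Finset.mem_powersetCard] at h h'
    have h1 := inter_card_le ha hb hab
    have h2 := Finset.card_le_card (Finset.subset_inter (h.1.trans Finset.inter_subset_left)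
      (h'.1.trans Finset.inter_subset_left))
    omega
  have hc : ∀ i, (e i ∩ Y).card = 3 := he.card
  set F := D ∪ Finset.univ.image e with hF
  have hln : ∀ m ∈ F, K.IsLn m := by
    intro m hm
    rcases Finset.mem_union.1 hm with hm | hm
    · exact (hD m hm).1
    · obtain ⟨i, -, rfl⟩ := Finset.mem_image.1 hm
      exact he.ln i
  have h1 : (F.biUnion fun m => (m ∩ Y).powersetCard 2).card ≤ (Y.powersetCard 2).card :=
    Finset.card_le_card (Finset.biUnion_subset.2 fun m _ =>
      Finset.powersetCard_mono Finset.inter_subset_right)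
  rw [Finset.card_biUnion fun a ha b hb hab => hdis (hln a ha) (hln b hb) hab,
    Finset.card_powersetCard, hS.card_outer, hF, Finset.sum_union,
    Finset.sum_image (fun i _ j _ h => he.inj h),
    Finset.sum_congr rfl (g := fun _ => 1)] at h1
  · simp only [Finset.card_powersetCard, hc, Finset.sum_const, smul_eq_mul, mul_one,
      Finset.card_univ, Fintype.card_fin] at h1
    have : Nat.choose 6 2 = 15 := rfl
    have : Nat.choose 3 2 = 3 := rfl
    omega
  · intro m hm
    rw [Finset.card_powersetCard, (hD m hm).2, Nat.choose_self]
  · rw [Finset.disjoint_left]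
    intro m hm hm'
    obtain ⟨i, -, rfl⟩ := Finset.mem_image.1 hm'
    have h2 := (hD _ hm).2
    have h3 := hc i
    omega

theorem IsCubic.used_ne (hS : K.IsCubic S) {B C : α} (hB : B ∈ inner S) (hC : C ∈ inner S)
    (h : B ≠ C) : (K.M B ∩ K.M C).card ≤ 4 := by
  by_contra! h1
  have h2 := hS.card_used_inner hB
  have h3 : K.M B ⊆ K.M C := by
    rw [← Finset.inter_eq_left]
    exact Finset.eq_of_subset_of_card_le Finset.inter_subset_left (by omega)
  obtain ⟨m, hm, hCm⟩ := K.M_cover (hS.inner_sub hB) (hS.inner_sub hC) h.symm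
  exact K.M_not_mem (hS.inner_sub hC) (h3 hm) hCm

/-- No node on the three lines uses three pairwise disjoint lines through five nodes each. -/
def NoSecond (K : LineConfig α) (S : Fin 3 → Finset α) : Prop :=
  ∀ B ∈ inner S, ∀ d, K.IsCubic d → ¬ ∀ i, d i ∈ K.M B

/-- The transversal lines through four nodes that are used by exactly three nodes. -/
def exceptional (K : LineConfig α) (S : Fin 3 → Finset α) : Finset (Finset α) :=
  (K.transversals S).filter fun m => (m ∩ K.outer S).card = 1 ∧ (K.users S m).card = 3

/-- The transversal lines through five nodes. -/
def fullTransversals (K : LineConfig α) (S : Fin 3 → Finset α) : Finset (Finset α) :=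
  (K.transversals S).filter fun m => (m ∩ K.outer S).card = 2

theorem IsCubic.card_users_full_le (hS : K.IsCubic S) (hn : NoSecond K S) {m : Finset α}
    (hm : m ∈ K.transversals S) (hy : (m ∩ K.outer S).card = 2) : (K.users S m).card ≤ 4 := by
  by_contra! h
  obtain ⟨U, hU, cU⟩ := Finset.exists_subset_card_eq (show 5 ≤ (K.users S m).card from h)
  obtain ⟨B, hB⟩ := Finset.card_pos.1 (by omega : 0 < U.card)
  have hUS : U ⊆ inner S := fun C hC => (mem_users.1 (hU hC)).1
  have hc := hS.card_transversal (hS.ln_of_mem_transversals hm) (mem_transversals.1 hm).2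
  obtain ⟨d, hd, hdB⟩ := hS.exists_isCubic_of_five hUS cU (by omega)
    (fun C hC => (mem_users.1 (hU hC)).2) hB
  exact hn B (hUS hB) d hd hdB

theorem IsCubic.card_users_le (hS : K.IsCubic S) (hn : NoSecond K S) {m : Finset α}
    (hm : m ∈ K.transversals S) :
    (K.users S m).card ≤ 2 + (if (m ∩ K.outer S).card = 2 then 2 else 0) +
      (if (m ∩ K.outer S).card = 1 ∧ (K.users S m).card = 3 then 1 else 0) := by
  have hml := hS.ln_of_mem_transversals hm
  have hc := hS.card_transversal hml (mem_transversals.1 hm).2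
  have h5 := K.ln_card hml
  by_cases h2 : (m ∩ K.outer S).card = 2
  · have := hS.card_users_full_le hn hm h2
    rw [if_pos h2]
    omega
  rw [if_neg h2]
  by_contra! h
  by_cases h1 : (m ∩ K.outer S).card = 1
  · have h4 : 4 ≤ (K.users S m).card := by
      by_contra h3
      rw [if_pos ⟨h1, by split_ifs at h <;> omega⟩] at h
      omega
    obtain ⟨U, hU, cU⟩ := Finset.exists_subset_card_eq h4
    exact hS.not_four_users (fun C hC => (mem_users.1 (hU hC)).1) cU (by omega)
      fun C hC => (mem_users.1 (hU hC)).2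
  · obtain ⟨U, hU, cU⟩ := Finset.exists_subset_card_eq
      (show 3 ≤ (K.users S m).card by split_ifs at h <;> omega)
    obtain ⟨B, hB⟩ := Finset.card_pos.1 (by omega : 0 < U.card)
    have hUS : U ⊆ inner S := fun C hC => (mem_users.1 (hU hC)).1
    obtain ⟨d, hd, hdB⟩ := hS.exists_isCubic_of_three hUS cU (by omega)
      (fun C hC => (mem_users.1 (hU hC)).2) hB
    exact hn B (hUS hB) d hd hdB

theorem IsCubic.exists_shared_full (hS : K.IsCubic S) {m : Finset α}
    (hm : m ∈ K.exceptional S) :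
    ∃ Q : Finset (Finset α), m ∈ Q ∧ Q.card = 4 ∧ (∀ C ∈ K.users S m, Q ⊆ K.M C) ∧
      2 ≤ (Q.filter fun a => a ∈ K.fullTransversals S).card := by
  obtain ⟨hm, h1, h3⟩ := Finset.mem_filter.1 hm
  have hc := hS.card_transversal (hS.ln_of_mem_transversals hm) (mem_transversals.1 hm).2
  have hUS : K.users S m ⊆ inner S := fun C hC => (mem_users.1 hC).1
  obtain ⟨a, b, c, hab, ca, cb, hQ, hu⟩ := hS.exists_shared hUS h3 (by omega)
    fun C hC => (mem_users.1 hC).2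
  obtain ⟨B, hB, C, hC, hBC⟩ := Finset.one_lt_card.1 (by omega : 1 < (K.users S m).card)
  have full : ∀ x ∈ ({m, a, b, c} : Finset (Finset α)), x.card = 5 → x ∈ K.fullTransversals S := by
    intro x hx cx
    have ht : Transversal S x := by
      by_contra ht
      obtain ⟨i, hi⟩ := mem_inner.1 (hUS hB)
      exact hBC (hS.unique_user hi (hu B hB hx) (hS.inter_eq_empty hi (hu B hB hx) ht)
        (hUS hC) (hu C hC hx)).symm
    refine Finset.mem_filter.2 ⟨mem_transversals.2 ⟨⟨B, hUS hB, hu B hB hx⟩, ht⟩, ?_⟩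
    have := hS.card_transversal (K.M_ln (hS.inner_sub (hUS hB)) (hu B hB hx)) ht
    omega
  refine ⟨{m, a, b, c}, by simp, hQ, hu, ?_⟩
  rw [← Finset.card_pair hab]
  refine Finset.card_le_card ?_
  simp [Finset.insert_subset_iff, full a (by simp) ca, full b (by simp) cb]

theorem IsCubic.card_exceptional_le (hS : K.IsCubic S) (hn : NoSecond K S) :
    (K.exceptional S).card ≤ (K.fullTransversals S).card := by
  choose! Q hmQ cQ hQ hfull using fun m (hm : m ∈ K.exceptional S) => hS.exists_shared_full hm
  have h := Finset.card_mul_le_card_mul (s := K.exceptional S) (t := K.fullTransversals S)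
    (m := 2) (n := 2) (fun m d => d ∈ Q m) ?_ ?_
  · omega
  · intro m hm
    refine (hfull m hm).trans (Finset.card_le_card fun d hd => ?_)
    rw [Finset.mem_filter] at hd
    exact Finset.mem_filter.2 ⟨hd.2, hd.1⟩
  · intro d hd
    rcases Finset.eq_empty_or_nonempty
      ((K.exceptional S).bipartiteBelow (fun m d => d ∈ Q m) d) with he | ⟨n, hnd⟩
    · simp [he]
    obtain ⟨hnE, hdn⟩ := (Finset.mem_bipartiteBelow _).1 hnd
    have hsub : ∀ m, m ∈ (K.exceptional S).bipartiteBelow (fun m d => d ∈ Q m) d →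
        m ∈ Q n \ (Q n).filter (fun a => a ∈ K.fullTransversals S) := by
      intro m hmd
      obtain ⟨hmE, hdm⟩ := (Finset.mem_bipartiteBelow _).1 hmd
      obtain ⟨hdT, hd2⟩ := Finset.mem_filter.1 hd
      obtain ⟨hmT, hm1, hm3⟩ := Finset.mem_filter.1 hmE
      obtain ⟨hnT, hn1, hn3⟩ := Finset.mem_filter.1 hnE
      have hu : ∀ x ∈ K.exceptional S, d ∈ Q x → K.users S x ⊆ K.users S d := by
        intro x hx hdx C hC
        exact mem_users.2 ⟨(mem_users.1 hC).1, hQ x hx C hC hdx⟩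
      have h1 := Finset.card_le_card (Finset.union_subset (hu m hmE hdm) (hu n hnE hdn))
      have h2 := hS.card_users_full_le hn hdT hd2
      have h3 := Finset.card_union_add_card_inter (K.users S m) (K.users S n)
      obtain ⟨B, hB, C, hC, hBC⟩ :=
        Finset.one_lt_card.1 (by omega : 1 < (K.users S m ∩ K.users S n).card)
      obtain ⟨hBm, hBn⟩ := Finset.mem_inter.1 hB
      obtain ⟨hCm, hCn⟩ := Finset.mem_inter.1 hC
      have h4 := hS.used_ne (mem_users.1 hBm).1 (mem_users.1 hCm).1 hBC
      have eqQ : ∀ x ∈ K.exceptional S, B ∈ K.users S x → C ∈ K.users S x →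
          Q x = K.M B ∩ K.M C := fun x hx h h' =>
        Finset.eq_of_subset_of_card_le (Finset.subset_inter (hQ x hx B h) (hQ x hx C h'))
          (by rw [cQ x hx]; exact h4)
      refine Finset.mem_sdiff.2 ⟨?_, ?_⟩
      · rw [eqQ n hnE hBn hCn, ← eqQ m hmE hBm hCm]
        exact hmQ m hmE
      · intro hf
        have := (Finset.mem_filter.1 (Finset.mem_filter.1 hf).2).2
        omega
    refine (Finset.card_le_card hsub).trans ?_
    rw [Finset.card_sdiff_of_subset (Finset.filter_subset _ _), cQ n hnE]
    have := hfull n hnE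
    omega

theorem IsCubic.not_noSecond (hS : K.IsCubic S) : ¬ NoSecond K S := by
  intro hn
  have h1 : ∑ m ∈ K.transversals S, (K.users S m).card ≤
      (K.transversals S).card * 2 + (K.fullTransversals S).card * 2 +
        (K.exceptional S).card := by
    refine (Finset.sum_le_sum fun m hm => hS.card_users_le hn hm).trans ?_
    rw [Finset.sum_add_distrib, Finset.sum_add_distrib, Finset.sum_const, ← Finset.sum_filter,
      Finset.sum_const, ← Finset.sum_filter, Finset.sum_const]
    simp [fullTransversals, exceptional]
  have h2 := hS.card_exceptional_le hn
  have h3 : (K.fullTransversals S).card ≤ 6 := hS.card_two_le fun m hm => by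
    obtain ⟨hm, h⟩ := Finset.mem_filter.1 hm
    exact ⟨hS.ln_of_mem_transversals hm, h⟩
  have h4 : ∀ i, 20 ≤ ∑ B ∈ S i, ((K.M B).filter (Transversal S)).card := by
    intro i
    have := Finset.card_nsmul_le_sum (S i) (fun B => ((K.M B).filter (Transversal S)).card) 4
      fun B hB => hS.four_le_card_filter hB
    rw [hS.card] at this
    exact this
  have h5 := hS.card_transversals_le
  rw [hS.sum_users, Fin.sum_univ_three] at h1
  have := h4 0
  have := h4 1
  have := h4 2
  have := h5 0
  have := h5 1
  have := h5 2
  omega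

/-- Two triples of pairwise disjoint lines meeting in nine nodes. -/
structure IsGrid (K : LineConfig α) (S d : Fin 3 → Finset α) : Prop where
  left : K.IsCubic S
  right : K.IsCubic d
  inter : ∀ i j, (d i ∩ S j).card = 1

theorem IsCubic.isGrid (hS : K.IsCubic S) {d : Fin 3 → Finset α} {B : α} (hB : B ∈ inner S)
    (hd : K.IsCubic d) (hdB : ∀ i, d i ∈ K.M B) : IsGrid K S d := by
  obtain ⟨l, hl⟩ := mem_inner.1 hB
  have h1 : ∀ i j, (d i ∩ S j).card ≤ 1 := fun i j => hS.inter_le hl (hdB i) j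
  have h2 := fun i => hS.card_eq (hd.sub i)
  have h3 := hd.card_inter_inner (K.outer S)
  have h4 := Finset.card_le_card (Finset.inter_subset_left : K.outer S ∩ inner d ⊆ K.outer S)
  rw [h3, hS.card_outer, Fin.sum_univ_three] at h4
  simp only [hd.card] at h2
  simp only [Finset.inter_comm (K.outer S)] at h4
  refine ⟨hS, hd, fun i j => ?_⟩
  have a := h2 0
  have b := h2 1
  have c := h2 2
  have := h1 0 0
  have := h1 0 1
  have := h1 0 2
  have := h1 1 0
  have := h1 1 1
  have := h1 1 2
  have := h1 2 0
  have := h1 2 1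
  have := h1 2 2
  fin_cases i <;> fin_cases j <;> simp only [Fin.zero_eta, Fin.mk_one, Fin.reduceFinMk] <;> omega

section Grid

variable {d : Fin 3 → Finset α}

theorem IsGrid.symm (h : IsGrid K S d) : IsGrid K d S :=
  ⟨h.right, h.left, fun i j => by rw [Finset.inter_comm]; exact h.inter j i⟩

theorem IsGrid.card_inter_outer (h : IsGrid K S d) (i : Fin 3) :
    (d i ∩ K.outer S).card = 2 := by
  have h2 := h.left.card_eq (h.right.sub i)
  rw [h.right.card, h.inter, h.inter, h.inter] at h2
  omega

theorem IsGrid.outer_subset (h : IsGrid K S d) : K.outer S ⊆ inner d := by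
  have h1 := h.right.card_inter_inner (K.outer S)
  simp only [Finset.inter_comm (K.outer S) (d _), h.card_inter_outer] at h1
  rw [← Finset.inter_eq_left]
  refine Finset.eq_of_subset_of_card_le Finset.inter_subset_left ?_
  rw [h1, h.left.card_outer]
  simp

theorem IsGrid.card_grid (h : IsGrid K S d) : (inner S ∩ inner d).card = 9 := by
  rw [h.right.card_inter_inner]
  simp only [Finset.inter_comm (inner S) (d _), h.left.card_inter_inner, h.inter]
  simp

theorem IsTriangle.partner {v w : Fin 3 → α} {e : Fin 3 → Finset α} (he : IsTriangle K S v w e)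
    {m : Finset α} (hm : K.IsLn m) (hne : ∀ j, m ≠ e j) {i : Fin 3} (hv : v i ∈ m) :
    m ∩ K.outer S ⊆ {v i, w i} := by
  intro P hP
  obtain ⟨hPm, hPY⟩ := Finset.mem_inter.1 hP
  simp only [Finset.mem_insert, Finset.mem_singleton]
  by_contra! h
  obtain ⟨j, hj⟩ := he.cover P hPY
  have hij : i ≠ j := by
    rintro rfl
    rcases hj with hj | hj
    exacts [h.1 hj, h.2 hj]
  rcases hj with hj | hj
  · obtain ⟨k, hki, hkj⟩ := exists_third i j hij
    exact hne k (K.ln_eq hm (he.ln k) h.1 hPm hv (hj ▸ he.v_mem k j hkj) (he.v_mem k i hki))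
  · exact hne j (K.ln_eq hm (he.ln j) h.1 hPm hv (hj ▸ he.w_mem j) (he.v_mem j i hij.symm))

theorem IsGrid.ne_side (h : IsGrid K S d) {v w : Fin 3 → α} {e : Fin 3 → Finset α}
    (he : IsTriangle K S v w e) (i j : Fin 3) : d i ≠ e j := by
  intro hij
  have h1 := h.card_inter_outer i
  have h2 := he.card j
  rw [hij] at h1
  omega

theorem IsGrid.eq_of_vertex (h : IsGrid K S d) {v w : Fin 3 → α} {e : Fin 3 → Finset α}
    (he : IsTriangle K S v w e) {m : Finset α} (hm : K.IsLn m) (hne : ∀ j, m ≠ e j)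
    (h2 : 2 ≤ (m ∩ K.outer S).card) {i : Fin 3} (hv : v i ∈ m) : ∃ j, m = d j := by
  obtain ⟨j, hj⟩ := mem_inner.1 (h.outer_subset (he.v_outer i))
  refine ⟨j, eq_of_two_le hm (h.right.ln j) ?_⟩
  have cp : ({v i, w i} : Finset α).card ≤ 2 := Finset.card_le_two
  have e1 := Finset.eq_of_subset_of_card_le (he.partner hm hne hv) (cp.trans h2)
  have e2 := Finset.eq_of_subset_of_card_le (he.partner (h.right.ln j) (h.ne_side he j) hj)
    (by rw [h.card_inter_outer]; exact cp)
  refine h2.trans (Finset.card_le_card (Finset.subset_inter Finset.inter_subset_left ?_))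
  rw [e1, ← e2]
  exact Finset.inter_subset_left

theorem IsGrid.exists_eq {c : Fin 3 → Finset α} (h : IsGrid K S d) (h' : IsGrid K S c) :
    ∃ i j, c i = d j := by
  obtain ⟨v, w, e, he⟩ := h.left.exists_isTriangle
  obtain ⟨i, hi⟩ := mem_inner.1 (h'.outer_subset (he.v_outer 0))
  exact ⟨i, h.eq_of_vertex he (h'.right.ln i) (h'.ne_side he i) (h'.card_inter_outer i).ge hi⟩

theorem IsGrid.exists_classification (h : IsGrid K S d) :
    ∃ (E : Finset (Finset α)) (w : Finset α), w ⊆ K.outer S ∧ w.card ≤ 3 ∧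
      (∀ m ∈ E, (m ∩ K.outer S).card = 3) ∧
      ∀ m, K.IsLn m → 2 ≤ (m ∩ K.outer S).card → (∀ i, m ≠ d i) → m ∈ E ∨ 2 ≤ (m ∩ w).card := by
  obtain ⟨v, w, e, he⟩ := h.left.exists_isTriangle
  refine ⟨Finset.univ.image e, Finset.univ.image w, ?_, ?_, ?_, ?_⟩
  · intro P hP
    obtain ⟨i, -, rfl⟩ := Finset.mem_image.1 hP
    exact he.w_outer i
  · exact Finset.card_image_le
  · intro m hm
    obtain ⟨i, -, rfl⟩ := Finset.mem_image.1 hm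
    exact he.card i
  · intro m hm h2 hd
    by_cases hne : ∀ j, m ≠ e j
    · refine Or.inr (h2.trans (Finset.card_le_card fun P hP => ?_))
      obtain ⟨hPm, hPY⟩ := Finset.mem_inter.1 hP
      obtain ⟨i, rfl | rfl⟩ := he.cover P hPY
      · obtain ⟨j, hj⟩ := h.eq_of_vertex he hm hne h2 hPm
        exact absurd hj (hd j)
      · exact Finset.mem_inter.2 ⟨hPm, Finset.mem_image_of_mem _ (Finset.mem_univ i)⟩
    · push Not at hne
      obtain ⟨j, rfl⟩ := hne
      exact Or.inl (Finset.mem_image_of_mem _ (Finset.mem_univ j))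

theorem card_le_three {F : Finset (Finset α)} {w : Finset α} (hw : w.card ≤ 3)
    (hF : ∀ m ∈ F, K.IsLn m ∧ 2 ≤ (m ∩ w).card) : F.card ≤ 3 := by
  choose! p hp cp using fun m (hm : m ∈ F) => Finset.exists_subset_card_eq (hF m hm).2
  have h1 : F.card ≤ (w.powersetCard 2).card := by
    refine Finset.card_le_card_of_injOn p (fun m hm => ?_) fun m hm n hn hmn => ?_
    · exact Finset.mem_powersetCard.2 ⟨(hp m hm).trans Finset.inter_subset_right, cp m hm⟩
    · refine eq_of_two_le (hF m hm).1 (hF n hn).1 ((cp m hm).ge.trans (Finset.card_le_card ?_))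
      exact Finset.subset_inter ((hp m hm).trans Finset.inter_subset_left)
        (hmn ▸ (hp n hn).trans Finset.inter_subset_left)
  rw [Finset.card_powersetCard] at h1
  exact h1.trans (Nat.choose_le_choose 2 hw)

theorem exists_mem_inter {m n w : Finset α} (hw : w.card ≤ 3) (hm : 2 ≤ (m ∩ w).card)
    (hn : 2 ≤ (n ∩ w).card) : ∃ P ∈ w, P ∈ m ∧ P ∈ n := by
  have h1 := Finset.card_union_add_card_inter (m ∩ w) (n ∩ w)
  have h2 := Finset.card_le_card
    (Finset.union_subset Finset.inter_subset_right Finset.inter_subset_right : m ∩ w ∪ n ∩ w ⊆ w)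
  obtain ⟨P, hP⟩ := Finset.card_pos.1 (by omega : 0 < (m ∩ w ∩ (n ∩ w)).card)
  simp only [Finset.mem_inter] at hP
  exact ⟨P, hP.1.2, hP.1.1, hP.2.1⟩

theorem IsCubic.not_isGrid (hS : K.IsCubic S) : ¬ IsGrid K S d := by
  intro h
  have hd := h.right
  set G := inner S ∩ inner d with hG
  have hGS : ∀ {B}, B ∈ G → B ∈ inner S := fun hB => (Finset.mem_inter.1 hB).1
  have hGd : ∀ {B}, B ∈ G → B ∈ inner d := fun hB => (Finset.mem_inter.1 hB).2
  set L := (G.biUnion K.M).filter (fun m => 2 ≤ (m ∩ K.outer S).card) with hL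
  set u : Finset α → Finset α := fun m => G.filter (fun B => m ∈ K.M B) with hu
  have memL : ∀ {m}, m ∈ L → (∃ B ∈ G, m ∈ K.M B) ∧ 2 ≤ (m ∩ K.outer S).card := by
    intro m hm
    simpa only [hL, Finset.mem_filter, Finset.mem_biUnion] using hm
  have lnL : ∀ {m}, m ∈ L → K.IsLn m := fun hm => by
    obtain ⟨⟨B, hB, hm⟩, -⟩ := memL hm
    exact K.M_ln (hS.inner_sub (hGS hB)) hm
  have neS : ∀ {m}, m ∈ L → ∀ i, m ≠ S i := by
    rintro m hm i rfl
    obtain ⟨⟨B, hB, hm⟩, -⟩ := memL hm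
    obtain ⟨j, hj⟩ := mem_inner.1 (hGS hB)
    exact hS.not_used hj i hm
  have ned : ∀ {m}, m ∈ L → ∀ i, m ≠ d i := by
    rintro m hm i rfl
    obtain ⟨⟨B, hB, hm⟩, -⟩ := memL hm
    obtain ⟨j, hj⟩ := mem_inner.1 (hGd hB)
    exact hd.not_used hj i hm
  have hsum : 9 ≤ ∑ m ∈ L, (u m).card := by
    rw [← h.card_grid, ← hG]
    refine (Finset.card_le_card fun B hB => ?_).trans Finset.card_biUnion_le
    obtain ⟨i, hi⟩ := mem_inner.1 (hGS hB)
    have h1 := hS.le_sum_inter hi (R := K.outer S) Finset.sdiff_subset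
      fun hY => (Finset.mem_sdiff.1 hY).2 (hGS hB)
    rw [hS.card_outer] at h1
    obtain ⟨m, hm, h2⟩ : ∃ m ∈ K.M B, 2 ≤ (m ∩ K.outer S).card := by
      by_contra! h2
      have h3 := Finset.sum_le_card_nsmul (K.M B) (fun m => (m ∩ K.outer S).card) 1
        fun m hm => Nat.le_of_lt_succ (h2 m hm)
      rw [hS.card_used hi] at h3
      simp only [smul_eq_mul] at h3
      omega
    exact Finset.mem_biUnion.2 ⟨m, Finset.mem_filter.2 ⟨Finset.mem_biUnion.2 ⟨B, hB, hm⟩, h2⟩,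
      Finset.mem_filter.2 ⟨hB, hm⟩⟩
  set F := L.filter (fun m => Transversal S m ∧ Transversal d m) with hF
  have memF : ∀ {m}, m ∈ F → m ∈ L ∧ Transversal S m ∧ Transversal d m := Finset.mem_filter.1
  have cardF : ∀ {m}, m ∈ F → m.card = 5 ∧ (m ∩ K.outer S).card = 2 ∧
      (m ∩ K.outer d).card = 2 := by
    intro m hm
    obtain ⟨hmL, hmS, hmd⟩ := memF hm
    have h1 := hS.card_transversal (lnL hmL) hmS
    have h2 := hd.card_transversal (lnL hmL) hmd
    have h3 := (memL hmL).2
    have h4 := K.ln_card (lnL hmL)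
    omega
  have hle : ∀ m ∈ L, (u m).card ≤ 1 + if Transversal S m ∧ Transversal d m then 3 else 0 := by
    intro m hm
    split_ifs with ht
    · by_contra! h4
      obtain ⟨U, hU, cU⟩ := Finset.exists_subset_card_eq (show 5 ≤ (u m).card from h4)
      obtain ⟨B, hB⟩ := Finset.card_pos.1 (by omega : 0 < U.card)
      have hUG : ∀ C ∈ U, C ∈ G := fun C hC => (Finset.mem_filter.1 (hU hC)).1
      obtain ⟨c, hc, hcB⟩ := hS.exists_isCubic_of_five (fun C hC => hGS (hUG C hC)) cU
        (cardF (Finset.mem_filter.2 ⟨hm, ht⟩)).1 (fun C hC => (Finset.mem_filter.1 (hU hC)).2) hB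
      obtain ⟨i, j, hij⟩ := h.exists_eq (hS.isGrid (hGS (hUG B hB)) hc hcB)
      obtain ⟨k, hk⟩ := mem_inner.1 (hGd (hUG B hB))
      exact hd.not_used hk j (hij ▸ hcB i)
    · refine Finset.card_le_one.2 fun C hC B hB => ?_
      obtain ⟨hBG, hBm⟩ := Finset.mem_filter.1 hB
      obtain ⟨hCG, hCm⟩ := Finset.mem_filter.1 hC
      by_cases hmS : Transversal S m
      · have hmd : ¬ Transversal d m := fun hmd => ht ⟨hmS, hmd⟩
        obtain ⟨i, hi⟩ := mem_inner.1 (hGd hBG)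
        exact hd.unique_user hi hBm (hd.inter_eq_empty hi hBm hmd) (hGd hCG) hCm
      · obtain ⟨i, hi⟩ := mem_inner.1 (hGS hBG)
        exact hS.unique_user hi hBm (hS.inter_eq_empty hi hBm hmS) (hGS hCG) hCm
  have hsum' : ∑ m ∈ L, (u m).card ≤ L.card + 3 * F.card := by
    refine (Finset.sum_le_sum hle).trans ?_
    rw [Finset.sum_add_distrib, ← Finset.sum_filter, Finset.sum_const, Finset.sum_const, ← hF]
    simp [mul_comm]
  obtain ⟨E, w, hwY, hw3, hE, hcl⟩ := h.exists_classification
  obtain ⟨E', w', hwY', hw3', hE', hcl'⟩ := h.symm.exists_classification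
  have wF : ∀ {m}, m ∈ F → 2 ≤ (m ∩ w).card := by
    intro m hm
    refine (hcl m (lnL (memF hm).1) (memL (memF hm).1).2 (ned (memF hm).1)).resolve_left fun hmE => ?_
    have := hE m hmE
    have := (cardF hm).2.1
    omega
  have wL : ∀ {m}, m ∈ L → (m ∩ K.outer d).card = 2 → 2 ≤ (m ∩ w').card := by
    intro m hm h2
    refine (hcl' m (lnL hm) h2.ge (neS hm)).resolve_left fun hmE => ?_
    have := hE' m hmE
    omega
  have hF1 : F.card ≤ 1 := by
    refine Finset.card_le_one.2 fun m hm n hn => ?_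
    obtain ⟨P, hP, hPm, hPn⟩ := exists_mem_inter hw3 (wF hm) (wF hn)
    obtain ⟨Q, hQ, hQm, hQn⟩ := exists_mem_inter hw3' (wL (memF hm).1 (cardF hm).2.2)
      (wL (memF hn).1 (cardF hn).2.2)
    refine K.ln_eq (lnL (memF hm).1) (lnL (memF hn).1) ?_ hPm hQm hPn hQn
    rintro rfl
    exact (Finset.mem_sdiff.1 (hwY' hQ)).2 (h.outer_subset (hwY hP))
  have cardE : ∀ {m}, m ∈ L → m ∈ E → (m ∩ K.outer d).card = 2 := by
    intro m hm hmE
    obtain ⟨⟨B, hB, hBm⟩, -⟩ := memL hm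
    have h1 := hS.card_eq (K.ln_sub (lnL hm))
    have h2 := hd.card_eq (K.ln_sub (lnL hm))
    have h3 := K.ln_card (lnL hm)
    have h4 := hE m hmE
    have h5 : (m ∩ K.outer S).card ≤ (m ∩ inner d).card :=
      Finset.card_le_card (Finset.inter_subset_inter_left h.outer_subset)
    rw [hd.card_inter_inner, Fin.sum_univ_three] at h5
    obtain ⟨j, hj⟩ := mem_inner.1 (hGd hB)
    have h6 := hd.inter_le hj hBm
    have h60 := h6 0
    have h61 := h6 1
    have h62 := h6 2
    obtain ⟨i, hi⟩ := mem_inner.1 (hGS hB)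
    have h7 := fun k (hk : k ≠ i) => hS.inter_eq_one hk hi hBm
    have h8 : 2 ≤ (m ∩ S 0).card + (m ∩ S 1).card + (m ∩ S 2).card := by
      fin_cases i
      · have := h7 1 (by decide); have := h7 2 (by decide); omega
      · have := h7 0 (by decide); have := h7 2 (by decide); omega
      · have := h7 0 (by decide); have := h7 1 (by decide); omega
    omega
  have hLE : (L.filter (· ∈ E)).card + F.card ≤ 3 := by
    rw [← Finset.card_union_of_disjoint]
    · refine card_le_three (K := K) hw3' fun m hm => ?_
      rcases Finset.mem_union.1 hm with hm | hm
      · obtain ⟨hm, hmE⟩ := Finset.mem_filter.1 hm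
        exact ⟨lnL hm, wL hm (cardE hm hmE)⟩
      · exact ⟨lnL (memF hm).1, wL (memF hm).1 (cardF hm).2.2⟩
    · rw [Finset.disjoint_left]
      intro m hm hm'
      have := hE m (Finset.mem_filter.1 hm).2
      have := (cardF hm').2.1
      omega
  have hLw : (L.filter (· ∉ E)).card ≤ 3 := by
    refine card_le_three (K := K) hw3 fun m hm => ?_
    obtain ⟨hm, hmE⟩ := Finset.mem_filter.1 hm
    exact ⟨lnL hm, (hcl m (lnL hm) (memL hm).2 (ned hm)).resolve_left hmE⟩
  have := Finset.card_filter_add_card_filter_not (s := L) (· ∈ E)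
  omega

end Grid

theorem not_isCubic : ¬ K.IsCubic S := by
  intro hS
  have h := hS.not_noSecond
  simp only [NoSecond] at h
  push Not at h
  obtain ⟨B, hB, d, hd, hdB⟩ := h
  exact hS.not_isGrid (hS.isGrid hB hd hdB)

end Cubic
end LineConfig

theorem IsLinePoly.exists_coeff {l : MvPolynomial (Fin 2) ℝ} (hl : IsLinePoly l) :
    ∃ a b c e : ℝ, (a ^ 2 + b ^ 2) * e = 1 ∧ l = C a * X 0 + C b * X 1 + C c := by
  have h : l = C (l.coeff (Finsupp.single 0 1)) * X 0 + C (l.coeff (Finsupp.single 1 1)) * X 1 +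
      C (l.coeff 0) := by
    ext m
    have hm : m.degree = m 0 + m 1 := by simp [Finsupp.degree_eq_sum]
    have hX (i : Fin 2) : (X i : MvPolynomial (Fin 2) ℝ).coeff m
        = if Finsupp.single i 1 = m then 1 else 0 := coeff_X ..
    simp only [coeff_add, coeff_C_mul, hX, coeff_C]
    rcases Nat.lt_or_ge 1 m.degree with h1 | h1
    · have h0 (i : Fin 2) : Finsupp.single i 1 ≠ m := by
        rintro rfl; simp at h1
      have h2 : 0 ≠ m := by rintro rfl; simp at h1
      rw [coeff_eq_zero_of_totalDegree_lt]
      · simp [h0, h2]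
      · rw [show l.totalDegree = 1 from hl]
        exact h1
    · have : m = 0 ∨ m = Finsupp.single 0 1 ∨ m = Finsupp.single 1 1 := by
        have : (m 0 = 0 ∧ m 1 = 0) ∨ (m 0 = 1 ∧ m 1 = 0) ∨ (m 0 = 0 ∧ m 1 = 1) := by omega
        rcases this with h | h | h
        · left; ext i; fin_cases i <;> simp [h]
        · right; left; ext i; fin_cases i <;> simp [h]
        · right; right; ext i; fin_cases i <;> simp [h]
      rcases this with rfl | rfl | rfl <;>
        simp [Finsupp.single_left_inj, eq_comm (a := (0 : Fin 2 →₀ ℕ))]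
  generalize l.coeff (Finsupp.single 0 1) = a at h
  generalize l.coeff (Finsupp.single 1 1) = b at h
  refine ⟨a, b, _, (a ^ 2 + b ^ 2)⁻¹, mul_inv_cancel₀ fun h0 => ?_, h⟩
  have ha : a = 0 := by nlinarith [sq_nonneg a, sq_nonneg b]
  have hb : b = 0 := by nlinarith [sq_nonneg a, sq_nonneg b]
  have hl : l.totalDegree = 1 := hl
  rw [h, ha, hb] at hl
  simp at hl

/-- A parametrization of the line of `l`, and restriction of polynomials to it. -/
theorem IsLinePoly.exists_param {l : MvPolynomial (Fin 2) ℝ} (hl : IsLinePoly l) :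
    ∃ (φ : MvPolynomial (Fin 2) ℝ →ₐ[ℝ] Polynomial ℝ) (γ : ℝ → ℝ × ℝ), Function.Injective γ ∧
      (∀ A, ev l A = 0 ↔ ∃ t, γ t = A) ∧ (∀ p t, (φ p).eval t = ev p (γ t)) ∧
      (∀ p, (φ p).natDegree ≤ p.totalDegree) ∧ ∀ p, φ p = 0 ↔ l ∣ p := by
  obtain ⟨a, b, c, e, hab, rfl⟩ := hl.exists_coeff
  set l : MvPolynomial (Fin 2) ℝ := C a * X 0 + C b * X 1 + C c
  have hC : ((C a ^ 2 + C b ^ 2) * C e : MvPolynomial (Fin 2) ℝ) = 1 := by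
    rw [← C_pow, ← C_pow, ← C_add, ← C_mul, hab, C_1]
  let u : Fin 2 → Polynomial ℝ := ![.C (-(a * c * e)) - .C b * .X, .C (-(b * c * e)) + .C a * .X]
  let γ : ℝ → ℝ × ℝ := fun t => (-(a * c * e) - b * t, -(b * c * e) + a * t)
  let φ : MvPolynomial (Fin 2) ℝ →ₐ[ℝ] Polynomial ℝ := aeval u
  let ψ : Polynomial ℝ →ₐ[ℝ] MvPolynomial (Fin 2) ℝ :=
    Polynomial.aeval (C e * (C a * (X 1 + C (b * c * e)) - C b * (X 0 + C (a * c * e))))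
  have hev (A : ℝ × ℝ) : ev l A = a * A.1 + b * A.2 + c := by simp [l, ev]
  have hφl : φ l = 0 := by
    have h : (Polynomial.C (-(a * c * e) * a + -(b * c * e) * b + c) : Polynomial ℝ) = 0 := by
      rw [show -(a * c * e) * a + -(b * c * e) * b + c = 0 by linear_combination -c * hab,
        Polynomial.C_0]
    simp only [φ, l, u, map_add, map_mul, aeval_X, aeval_C, Matrix.cons_val_zero,
      Matrix.cons_val_one, Polynomial.algebraMap_eq]
    simp only [map_add, map_mul] at h
    linear_combination h
  have hψ (p : MvPolynomial (Fin 2) ℝ) : l ∣ p - ψ (φ p) := by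
    induction p using MvPolynomial.induction_on with
    | C r => simp [φ, ψ, ← algebraMap_eq]
    | add p q hp hq =>
      rw [map_add, map_add, add_sub_add_comm]
      exact dvd_add hp hq
    | mul_X p i hp =>
      have hi : l ∣ X i - ψ (φ (X i)) := by
        fin_cases i
        · refine ⟨C (a * e), ?_⟩
          simp [φ, ψ, u, l, algebraMap_eq]
          linear_combination (-(X 0 + C a * C c * C e) + C a * C c * C e) * hC
        · refine ⟨C (b * e), ?_⟩
          simp [φ, ψ, u, l, algebraMap_eq]
          linear_combination (-(X 1 + C b * C c * C e) + C b * C c * C e) * hC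
      rw [map_mul, map_mul, show p * X i - ψ (φ p) * ψ (φ (X i))
        = (p - ψ (φ p)) * X i + ψ (φ p) * (X i - ψ (φ (X i))) by ring]
      exact dvd_add (hp.mul_right _) (hi.mul_left _)
  refine ⟨φ, γ, fun s t h => ?_, fun A => ⟨fun h => ?_, ?_⟩, fun p t => ?_, fun p => ?_,
    fun p => ⟨fun h => ?_, ?_⟩⟩
  · simp only [γ, Prod.mk.injEq] at h
    linear_combination a * e * h.2 - b * e * h.1 - (s - t) * hab
  · rw [hev] at h
    refine ⟨e * (a * A.2 - b * A.1), Prod.ext ?_ ?_⟩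
    · simp only [γ]
      linear_combination -a * e * h + A.1 * hab
    · simp only [γ]
      linear_combination -b * e * h + A.2 * hab
  · rintro ⟨t, rfl⟩
    simp only [hev, γ]
    linear_combination -c * hab
  · have h : (Polynomial.aeval t).comp φ = aeval ![(γ t).1, (γ t).2] := by
      ext i
      fin_cases i <;> simp [φ, u, γ]
    have := DFunLike.congr_fun h p
    simpa [ev, aeval_eq_eval, Polynomial.coe_aeval_eq_eval] using this
  · have h := aeval_natDegree_le p le_rfl u (n := 1) fun i => by
      fin_cases i
      · simp only [u]; dsimp; compute_degree
      · simp only [u]; dsimp; compute_degree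
    simpa using h
  · have := hψ p
    rwa [h, map_zero, sub_zero] at this
  · rintro ⟨q, rfl⟩
    rw [map_mul, hφl, zero_mul]

theorem ev_add (p q : MvPolynomial (Fin 2) ℝ) (A : ℝ × ℝ) : ev (p + q) A = ev p A + ev q A :=
  map_add _ p q

theorem ev_smul (r : ℝ) (p : MvPolynomial (Fin 2) ℝ) (A : ℝ × ℝ) : ev (r • p) A = r * ev p A :=
  smul_eval _ p r

theorem ev_mul (p q : MvPolynomial (Fin 2) ℝ) (A : ℝ × ℝ) : ev (p * q) A = ev p A * ev q A :=
  map_mul _ p q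

theorem ev_prod {ι : Type*} (s : Finset ι) (f : ι → MvPolynomial (Fin 2) ℝ) (A : ℝ × ℝ) :
    ev (∏ i ∈ s, f i) A = ∏ i ∈ s, ev (f i) A :=
  map_prod _ f s

theorem ev_eq_zero_of_dvd {p q : MvPolynomial (Fin 2) ℝ} {A : ℝ × ℝ} (h : p ∣ q)
    (hp : ev p A = 0) : ev q A = 0 := by
  obtain ⟨r, rfl⟩ := h
  rw [ev_mul, hp, zero_mul]

namespace IsLinePoly

variable {l : MvPolynomial (Fin 2) ℝ}

theorem ne_zero (hl : IsLinePoly l) : l ≠ 0 := by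
  rintro rfl
  simp [IsLinePoly] at hl

theorem totalDegree_mul (hl : IsLinePoly l) {q : MvPolynomial (Fin 2) ℝ} (hq : q ≠ 0) :
    (l * q).totalDegree = q.totalDegree + 1 := by
  rw [totalDegree_mul_of_isDomain hl.ne_zero hq, hl, add_comm]

theorem prime (hl : IsLinePoly l) : Prime l := by
  obtain ⟨φ, γ, -, hγ, hφ, -, hd⟩ := hl.exists_param
  refine ⟨hl.ne_zero, fun h => ?_, fun p q h => ?_⟩
  · have h1 := (hd 1).2 h.dvd
    simp at h1
  · rw [← hd, map_mul, mul_eq_zero, hd, hd] at h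
    exact h

theorem dvd_of_card (hl : IsLinePoly l) {p : MvPolynomial (Fin 2) ℝ} {T : Finset (ℝ × ℝ)}
    (hp : p.totalDegree < T.card) (hT : ∀ A ∈ T, ev l A = 0) (hpT : ∀ A ∈ T, ev p A = 0) :
    l ∣ p := by
  classical
  obtain ⟨φ, γ, hi, hγ, hφ, hn, hd⟩ := hl.exists_param
  choose! τ hτ using fun A (hA : A ∈ T) => (hγ A).1 (hT A hA)
  rw [← hd]
  refine Polynomial.eq_zero_of_natDegree_lt_card_of_eval_eq_zero' _ (T.image τ) ?_ ?_
  · intro t ht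
    obtain ⟨A, hA, rfl⟩ := Finset.mem_image.1 ht
    rw [hφ, hτ A hA, hpT A hA]
  · rw [Finset.card_image_of_injOn fun A hA B hB h => by
      rw [← hτ A hA, ← hτ B hB, h]]
    exact (hn p).trans_lt hp

theorem dvd_comm (hl : IsLinePoly l) {m : MvPolynomial (Fin 2) ℝ} (hm : IsLinePoly m)
    (h : l ∣ m) : m ∣ l :=
  ((hl.prime.dvd_prime_iff_associated hm.prime).1 h).symm.dvd

theorem ev_eq_zero_iff (hl : IsLinePoly l) {m : MvPolynomial (Fin 2) ℝ} (hm : IsLinePoly m)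
    (h : l ∣ m) (A : ℝ × ℝ) : ev l A = 0 ↔ ev m A = 0 :=
  ⟨ev_eq_zero_of_dvd h, ev_eq_zero_of_dvd (hl.dvd_comm hm h)⟩

/-- Every line has arbitrarily many points off a given finite set. -/
theorem exists_points (hl : IsLinePoly l) (N : Finset (ℝ × ℝ)) (n : ℕ) :
    ∃ T : Finset (ℝ × ℝ), T.card = n ∧ Disjoint N T ∧ ∀ A ∈ T, ev l A = 0 := by
  obtain ⟨φ, γ, hi, hγ, -⟩ := hl.exists_param
  obtain ⟨T, hT, cT⟩ := (((Set.infinite_range_of_injective hi).sdiff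
    N.finite_toSet)).exists_subset_card_eq n
  refine ⟨T, cT, Finset.disjoint_right.2 fun A hA => (hT hA).2, fun A hA => ?_⟩
  exact (hγ A).2 (hT hA).1

end IsLinePoly

/-- The polynomials of degree at most `k` vanishing on `N`. -/
noncomputable def vanishing (k : ℕ) (N : Finset (ℝ × ℝ)) :
    Submodule ℝ (MvPolynomial (Fin 2) ℝ) where
  carrier := {p | p.totalDegree ≤ k ∧ ∀ A ∈ N, ev p A = 0}
  add_mem' {p q} hp hq := ⟨(totalDegree_add p q).trans (max_le hp.1 hq.1), fun A hA => by
    rw [ev_add, hp.2 A hA, hq.2 A hA, add_zero]⟩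
  zero_mem' := by simp [ev]
  smul_mem' r p hp := ⟨(totalDegree_smul_le r p).trans hp.1, fun A hA => by
    rw [ev_smul, hp.2 A hA, mul_zero]⟩

section Vanishing

variable {k : ℕ} {N N' T : Finset (ℝ × ℝ)} {p l : MvPolynomial (Fin 2) ℝ}

instance : Module.Finite ℝ (vanishing k N) :=
  Submodule.finiteDimensional_of_le (S₂ := restrictTotalDegree (Fin 2) ℝ k) fun p hp =>
    (mem_restrictTotalDegree (σ := Fin 2) k p).2 hp.1

open Module in
theorem finrank_vanishing_le [DecidableEq (ℝ × ℝ)] (k : ℕ) (N T : Finset (ℝ × ℝ)) :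
    finrank ℝ (vanishing k N) ≤ T.card + finrank ℝ (vanishing k (N ∪ T)) := by
  let e : vanishing k N →ₗ[ℝ] (T → ℝ) :=
    { toFun := fun p A => ev p A
      map_add' := fun p q => funext fun A => by simp only [Submodule.coe_add, Pi.add_apply, ev_add]
      map_smul' := fun r p => funext fun A => by
        simp only [Submodule.coe_smul, Pi.smul_apply, ev_smul, smul_eq_mul, RingHom.id_apply] }
  have h := LinearMap.finrank_range_add_finrank_ker e
  have h1 : finrank ℝ (LinearMap.range e) ≤ T.card := by
    simpa using Submodule.finrank_le (LinearMap.range e)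
  have h2 : finrank ℝ (LinearMap.ker e) ≤ finrank ℝ (vanishing k (N ∪ T)) := by
    rw [← LinearMap.finrank_range_of_inj
      (f := (vanishing k N).subtype ∘ₗ (LinearMap.ker e).subtype)
      (Subtype.val_injective.comp Subtype.val_injective)]
    refine Submodule.finrank_mono ?_
    rintro _ ⟨⟨p, hp⟩, rfl⟩
    refine ⟨p.2.1, fun A hA => ?_⟩
    rcases Finset.mem_union.1 hA with hA | hA
    · exact p.2.2 A hA
    · exact congrFun (LinearMap.mem_ker.1 hp) ⟨A, hA⟩
  omega

open Module in
theorem finrank_vanishing_step (hl : IsLinePoly l) (hN : k + 2 ≤ N.card)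
    (hNl : ∀ A ∈ N, ev l A = 0) (hN' : ∀ A ∈ N', ev l A ≠ 0) (hT : N ⊆ T) (hT' : N' ⊆ T) :
    finrank ℝ (vanishing (k + 1) T) ≤ finrank ℝ (vanishing k N') := by
  refine le_trans (Submodule.finrank_mono ?_)
    (Submodule.finrank_map_le (LinearMap.mulLeft ℝ l) (vanishing k N'))
  intro p hp
  obtain ⟨q, rfl⟩ := hl.dvd_of_card (by have := hp.1; omega) hNl fun A hA => hp.2 A (hT hA)
  rcases eq_or_ne q 0 with rfl | hq
  · simp
  refine Submodule.mem_map_of_mem (f := LinearMap.mulLeft ℝ l) ⟨?_, fun A hA => ?_⟩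
  · have := hl.totalDegree_mul hq
    have := hp.1
    omega
  · have := hp.2 A (hT' hA)
    rw [ev_mul] at this
    exact (mul_eq_zero.1 this).resolve_left (hN' A hA)

open Module Classical in
theorem finrank_vanishing_succ_le (hl : IsLinePoly l) (k : ℕ) (N : Finset (ℝ × ℝ)) :
    finrank ℝ (vanishing (k + 1) N) ≤ (k + 2 - (N.filter (ev l · = 0)).card) +
      finrank ℝ (vanishing k (N.filter (ev l · ≠ 0))) := by
  obtain ⟨T, cT, hNT, hT⟩ := hl.exists_points N (k + 2 - (N.filter (ev l · = 0)).card)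
  have h := finrank_vanishing_le (k + 1) N T
  have h1 : finrank ℝ (vanishing (k + 1) (N ∪ T)) ≤
      finrank ℝ (vanishing k (N.filter (ev l · ≠ 0))) := by
    refine finrank_vanishing_step (N := N.filter (ev l · = 0) ∪ T) hl ?_ (fun A hA => ?_)
      (fun A hA => (Finset.mem_filter.1 hA).2)
      (Finset.union_subset_union_left (Finset.filter_subset _ _))
      ((Finset.filter_subset _ _).trans Finset.subset_union_left)
    · rw [Finset.card_union_of_disjoint (hNT.mono_left (Finset.filter_subset _ _)), cT]
      omega
    · rcases Finset.mem_union.1 hA with hA | hA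
      · exact (Finset.mem_filter.1 hA).2
      · exact hT A hA
  omega

open Module in
theorem finrank_vanishing_mul (hl : IsLinePoly l) (hT : ∀ A ∈ T, A ∈ N ∨ ev l A = 0) :
    finrank ℝ (vanishing k N) ≤ finrank ℝ (vanishing (k + 1) T) := by
  rw [← LinearMap.finrank_range_of_inj (f := LinearMap.mulLeft ℝ l ∘ₗ (vanishing k N).subtype)
    ((mul_right_injective₀ hl.ne_zero).comp Subtype.val_injective)]
  refine Submodule.finrank_mono ?_
  rintro _ ⟨⟨q, hq⟩, rfl⟩
  refine ⟨(totalDegree_mul _ _).trans ?_, fun A hA => ?_⟩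
  · rw [show l.totalDegree = 1 from hl, add_comm]
    exact Nat.succ_le_succ hq.1
  · change ev (l * q) A = 0
    rw [ev_mul, mul_eq_zero]
    exact (hT A hA).symm.imp_right (hq.2 A)

open Module in
theorem card_le_finrank_vanishing {q : ℝ × ℝ → MvPolynomial (Fin 2) ℝ}
    (hq : ∀ C ∈ T, q C ∈ vanishing k N) (h0 : ∀ C ∈ T, ev (q C) C ≠ 0)
    (h : ∀ C ∈ T, ∀ B ∈ T, B ≠ C → ev (q C) B = 0) :
    T.card ≤ finrank ℝ (vanishing k N) := by
  classical
  have hli : LinearIndependent ℝ fun C : T => (⟨q C, hq C C.2⟩ : vanishing k N) := by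
    rw [Fintype.linearIndependent_iff]
    intro g hg B
    have h1 := congrArg (fun p : vanishing k N => eval ![B.1.1, B.1.2] p.1) hg
    simp only [Submodule.coe_sum, Submodule.coe_smul, map_sum, smul_eval, Submodule.coe_zero,
      map_zero] at h1
    rw [Finset.sum_eq_single B (fun C _ hC => ?_) (by simp)] at h1
    · exact (mul_eq_zero.1 h1).resolve_right (h0 B B.2)
    · exact mul_eq_zero_of_right _ (h C C.2 B B.2 fun hh => hC (Subtype.ext hh.symm))
  simpa using hli.fintype_card_le_finrank

open Module in
theorem finrank_vanishing_zero_le : finrank ℝ (vanishing 0 N) ≤ 1 := by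
  refine le_trans (Submodule.finrank_mono (t := Submodule.span ℝ {1}) fun p hp => ?_)
    ((finrank_span_le_card _).trans (by simp))
  rw [totalDegree_eq_zero_iff_eq_C.1 (Nat.le_zero.1 hp.1), Submodule.mem_span_singleton]
  exact ⟨_, by rw [smul_eq_C_mul, mul_one]⟩

theorem finrank_vanishing_pos (hp : p ∈ vanishing k N) (h0 : p ≠ 0) :
    0 < Module.finrank ℝ (vanishing k N) :=
  Module.finrank_pos_iff_exists_ne_zero.2 ⟨⟨p, hp⟩, fun h => h0 (congrArg Subtype.val h)⟩

theorem exists_mem_vanishing (h : 0 < Module.finrank ℝ (vanishing k N)) :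
    ∃ p ∈ vanishing k N, p ≠ 0 := by
  obtain ⟨⟨p, hp⟩, h0⟩ := Module.finrank_pos_iff_exists_ne_zero.1 h
  exact ⟨p, hp, fun h => h0 (Subtype.ext h)⟩

end Vanishing

open Classical in
/-- The nodes of `X` on the line of `l`. -/
noncomputable def trace (X : Finset (ℝ × ℝ)) (l : MvPolynomial (Fin 2) ℝ) : Finset (ℝ × ℝ) :=
  X.filter (ev l · = 0)

theorem mem_trace {X : Finset (ℝ × ℝ)} {l : MvPolynomial (Fin 2) ℝ} {A : ℝ × ℝ} :
    A ∈ trace X l ↔ A ∈ X ∧ ev l A = 0 :=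
  Finset.mem_filter

/-- A `GC_5` set without maximal lines, with chosen linear factors `f A i` of the fundamental
polynomials. -/
structure IsFactored (X : Finset (ℝ × ℝ)) (f : ℝ × ℝ → Fin 5 → MvPolynomial (Fin 2) ℝ) :
    Prop where
  poised : Poised 5 X
  line : ∀ A ∈ X, ∀ i, IsLinePoly (f A i)
  fund : ∀ A ∈ X, IsFund 5 X A (∏ i, f A i)
  noMaximal : NoMaximalLine 5 X

namespace IsFactored

variable {X : Finset (ℝ × ℝ)} {f : ℝ × ℝ → Fin 5 → MvPolynomial (Fin 2) ℝ}
  {l m : MvPolynomial (Fin 2) ℝ} {A B : ℝ × ℝ}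

theorem card (h : IsFactored X f) : X.card = 21 := by
  have := h.poised.2.1
  rwa [Set.ncard_coe_finset] at this

theorem ev_factor_ne_zero (h : IsFactored X f) (hA : A ∈ X) (i : Fin 5) : ev (f A i) A ≠ 0 := by
  have := (h.fund A hA).2.1
  rw [ev_prod] at this
  intro h0
  rw [Finset.prod_eq_zero (Finset.mem_univ i) h0] at this
  exact zero_ne_one this

theorem exists_factor (h : IsFactored X f) (hA : A ∈ X) (hB : B ∈ X) (hBA : B ≠ A) :
    ∃ i, ev (f A i) B = 0 := by
  have := (h.fund A hA).2.2 B hB hBA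
  rw [ev_prod, Finset.prod_eq_zero_iff] at this
  simpa using this

theorem trace_eq_of_dvd (h : IsFactored X f) (hA : A ∈ X) (hl : IsLinePoly l)
    (hd : l ∣ ∏ i, f A i) : ∃ i, trace X (f A i) = trace X l := by
  obtain ⟨i, -, hi⟩ := hl.prime.exists_mem_finset_dvd hd
  refine ⟨i, ?_⟩
  ext B
  rw [mem_trace, mem_trace, hl.ev_eq_zero_iff (h.line A hA i) hi]

theorem card_trace_le (h : IsFactored X f) (hl : IsLinePoly l) : (trace X l).card ≤ 5 := by
  have h6 : (trace X l).card ≠ 6 := by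
    have := h.noMaximal l hl
    rwa [nodesOn, show (X : Set (ℝ × ℝ)) ∩ lineSet l = trace X l by
      ext A; simp [mem_trace, lineSet], Set.ncard_coe_finset] at this
  by_contra! h5
  classical
  obtain ⟨A, hA⟩ := Finset.card_pos.1 (by omega : 0 < (trace X l).card)
  have hAX := (mem_trace.1 hA).1
  have hd : l ∣ ∏ i, f A i := by
    refine hl.dvd_of_card (T := (trace X l).erase A) ?_ (fun B hB => ?_) fun B hB => ?_
    · rw [Finset.card_erase_of_mem hA]
      have := (h.fund A hAX).1
      omega
    · exact (mem_trace.1 (Finset.mem_of_mem_erase hB)).2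
    · obtain ⟨hBA, hB⟩ := Finset.mem_erase.1 hB
      exact (h.fund A hAX).2.2 B (mem_trace.1 hB).1 hBA
  have := (h.fund A hAX).2.1
  rw [ev_eq_zero_of_dvd hd (mem_trace.1 hA).2] at this
  exact zero_ne_one this

theorem eq_smul_fund (h : IsFactored X f) (hA : A ∈ X) {p : MvPolynomial (Fin 2) ℝ}
    (hp : p.totalDegree ≤ 5) (hp0 : ∀ B ∈ X, B ≠ A → ev p B = 0) :
    p = ev p A • ∏ i, f A i := by
  obtain ⟨h1, h2, h3⟩ := h.fund A hA
  have := h.poised.2.2 (p + (-ev p A) • ∏ i, f A i)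
    ((totalDegree_add _ _).trans (max_le hp ((totalDegree_smul_le _ _).trans h1))) fun B hB => by
      rw [ev_add, ev_smul]
      rcases eq_or_ne B A with rfl | hBA
      · rw [h2]; ring
      · rw [hp0 B hB hBA, h3 B hB hBA]; ring
  rw [neg_smul] at this
  exact eq_of_sub_eq_zero ((sub_eq_add_neg _ _).trans this)

theorem exists_trace_eq_of_dvd (h : IsFactored X f) (hA : A ∈ X) (hl : IsLinePoly l)
    {p : MvPolynomial (Fin 2) ℝ} (hd : l ∣ p) (hp : p.totalDegree ≤ 5) (h0 : p ≠ 0)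
    (hp0 : ∀ B ∈ X, B ≠ A → ev p B = 0) : ∃ i, trace X (f A i) = trace X l := by
  have hs := h.eq_smul_fund hA hp hp0
  have hc : ev p A ≠ 0 := fun hc => h0 (by rw [hs, hc, zero_smul])
  refine h.trace_eq_of_dvd hA hl ?_
  have := hd.mul_left (C (ev p A)⁻¹)
  rwa [hs, ← smul_eq_C_mul, ev_smul, (h.fund A hA).2.1, mul_one, inv_smul_smul₀ hc] at this

theorem six_le_finrank (h : IsFactored X f) : 6 ≤ Module.finrank ℝ (vanishing 2 ∅) := by
  obtain ⟨A, hA⟩ := Finset.card_pos.1 (by rw [h.card]; norm_num : 0 < X.card)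
  have h5 : X.card ≤ Module.finrank ℝ (vanishing 5 ∅) :=
    card_le_finrank_vanishing (q := fun A => ∏ i, f A i)
      (fun A hA => ⟨(h.fund A hA).1, by simp⟩)
      (fun A hA => by rw [(h.fund A hA).2.1]; exact one_ne_zero)
      fun A hA => (h.fund A hA).2.2
  have step (k : ℕ) : Module.finrank ℝ (vanishing (k + 1) ∅) ≤
      k + 2 + Module.finrank ℝ (vanishing k ∅) := by
    have := finrank_vanishing_succ_le (h.line A hA 0) k ∅
    rwa [Finset.filter_empty, Finset.filter_empty, Finset.card_empty, Nat.sub_zero] at this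
  have s2 : Module.finrank ℝ (vanishing 3 ∅) ≤ _ + Module.finrank ℝ (vanishing 2 ∅) := step 2
  have s3 : Module.finrank ℝ (vanishing 4 ∅) ≤ _ + Module.finrank ℝ (vanishing 3 ∅) := step 3
  have s4 : Module.finrank ℝ (vanishing 5 ∅) ≤ _ := step 4
  have := h.card
  omega

theorem exists_trace_eq_of_disjoint (h : IsFactored X f) {G : ℝ × ℝ}
    {a b c : MvPolynomial (Fin 2) ℝ}
    (ha : IsLinePoly a) (hb : IsLinePoly b) (hc : IsLinePoly c) (ca : (trace X a).card = 5)
    (cb : (trace X b).card = 5) (cc : (trace X c).card = 5)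
    (hab : Disjoint (trace X a) (trace X b)) (hac : Disjoint (trace X a) (trace X c))
    (hbc : Disjoint (trace X b) (trace X c)) (hG : G ∈ X) (hGa : G ∉ trace X a)
    (hGb : G ∉ trace X b) (hGc : G ∉ trace X c) : ∃ i, trace X (f G i) = trace X a := by
  classical
  set T := trace X a ∪ trace X b ∪ trace X c with hT
  have cT : T.card = 15 := by
    rw [hT, Finset.card_union_of_disjoint (Finset.disjoint_union_left.2 ⟨hac, hbc⟩),
      Finset.card_union_of_disjoint hab, ca, cb, cc]
  have hTX : T ⊆ X := Finset.union_subset (Finset.union_subset (Finset.filter_subset _ _)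
    (Finset.filter_subset _ _)) (Finset.filter_subset _ _)
  have hGT : G ∈ X \ T := by simp [hT, hG, hGa, hGb, hGc]
  have cY : ((X \ T).erase G).card = 5 := by
    rw [Finset.card_erase_of_mem hGT, Finset.card_sdiff_of_subset hTX, cT, h.card]
  have h2 := finrank_vanishing_le 2 ∅ ((X \ T).erase G)
  have h6 := h.six_le_finrank
  obtain ⟨q, ⟨hq, hq0⟩, hqn⟩ := exists_mem_vanishing (k := 2) (N := ∅ ∪ (X \ T).erase G) (by omega)
  have hcq := mul_ne_zero hc.ne_zero hqn
  have hbq := mul_ne_zero hb.ne_zero hcq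
  refine h.exists_trace_eq_of_dvd (p := a * (b * (c * q))) hG ha (dvd_mul_right _ _) ?_
    (mul_ne_zero ha.ne_zero hbq) fun B hB hBG => ?_
  · rw [ha.totalDegree_mul hbq, hb.totalDegree_mul hcq, hc.totalDegree_mul hqn]
    omega
  · simp only [ev_mul, mul_eq_zero]
    by_cases hBT : B ∈ T
    · simp only [hT, Finset.mem_union, mem_trace] at hBT
      tauto
    · exact Or.inr (Or.inr (Or.inr (hq0 B (by simp [hB, hBG, hBT]))))

theorem dvd_of_two_le (hl : IsLinePoly l) (hm : IsLinePoly m) {T : Finset (ℝ × ℝ)}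
    (cT : 2 ≤ T.card) (hlT : T ⊆ trace X l) (hmT : T ⊆ trace X m) : l ∣ m :=
  hl.dvd_of_card (T := T) (by rw [show m.totalDegree = 1 from hm]; omega)
    (fun A hA => (mem_trace.1 (hlT hA)).2) fun A hA => (mem_trace.1 (hmT hA)).2

open Classical in
theorem card_users_le (h : IsFactored X f) {U T : Finset (ℝ × ℝ)} (hU : U ⊆ X) (cT : 2 ≤ T.card)
    (hT : ∀ C ∈ U, ∃ i, trace X (f C i) = T) :
    U.card ≤ Module.finrank ℝ (vanishing 4 ((X \ T) \ U)) := by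
  rcases U.eq_empty_or_nonempty with rfl | ⟨D, hD⟩
  · simp
  obtain ⟨j, hj⟩ := hT D hD
  have hl := h.line D (hU hD) j
  have hd (C) (hC : C ∈ U) : ∃ q, ∏ i, f C i = f D j * q := by
    obtain ⟨i, hi⟩ := hT C hC
    exact (dvd_of_two_le hl (h.line C (hU hC) i) cT hj.ge hi.ge).trans
      (Finset.dvd_prod_of_mem _ (Finset.mem_univ i))
  choose! q hq using hd
  have hqC (C) (hC : C ∈ U) : ev (f D j) C * ev (q C) C = 1 := by
    rw [← ev_mul, ← hq C hC]
    exact (h.fund C (hU hC)).2.1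
  have hqB (C) (hC : C ∈ U) (B) (hB : B ∈ X) (hBC : B ≠ C) (hBD : ev (f D j) B ≠ 0) :
      ev (q C) B = 0 := by
    have := (h.fund C (hU hC)).2.2 B hB hBC
    rw [hq C hC, ev_mul] at this
    exact (mul_eq_zero.1 this).resolve_left hBD
  refine card_le_finrank_vanishing (q := q) (fun C hC => ⟨?_, fun B hB => ?_⟩)
    (fun C hC => right_ne_zero_of_mul_eq_one (hqC C hC))
    fun C hC B hB hBC => hqB C hC B (hU hB) hBC (left_ne_zero_of_mul_eq_one (hqC B hB))
  · have := (h.fund C (hU hC)).1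
    rw [hq C hC, hl.totalDegree_mul fun h0 => ?_] at this
    · omega
    · have := hqC C hC
      simp [h0, ev] at this
  · simp only [Finset.mem_sdiff, ← hj, mem_trace, not_and] at hB
    exact hqB C hC B hB.1.1 (fun hBC => hB.2 (hBC ▸ hC)) (hB.1.2 hB.1.1)

open Classical in
/-- The line configuration of a `GC_5` set without maximal lines. -/
noncomputable def lineConfig (h : IsFactored X f) : LineConfig (ℝ × ℝ) where
  X := X
  IsLn a := ∃ l, IsLinePoly l ∧ trace X l = a
  M B := Finset.univ.image fun i => trace X (f B i)
  rk k N := Module.finrank ℝ (vanishing k (N ∩ X))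
  card_X := h.card
  ln_sub := by
    rintro _ ⟨l, hl, rfl⟩
    exact Finset.filter_subset _ _
  ln_card := by
    rintro _ ⟨l, hl, rfl⟩
    exact h.card_trace_le hl
  ln_eq := by
    rintro _ _ P Q ⟨l, hl, rfl⟩ ⟨m, hm, rfl⟩ hPQ hP hQ hP' hQ'
    have hd : l ∣ m := dvd_of_two_le (X := X) (T := {P, Q}) hl hm (by rw [Finset.card_pair hPQ])
      (by simp [Finset.insert_subset_iff, hP, hQ]) (by simp [Finset.insert_subset_iff, hP', hQ'])
    ext B
    rw [mem_trace, mem_trace, hl.ev_eq_zero_iff hm hd]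
  M_ln := by
    intro B m hB hm
    obtain ⟨i, -, rfl⟩ := Finset.mem_image.1 hm
    exact ⟨_, h.line B hB i, rfl⟩
  M_not_mem := by
    intro B m hB hm
    obtain ⟨i, -, rfl⟩ := Finset.mem_image.1 hm
    exact fun hBm => h.ev_factor_ne_zero hB i (mem_trace.1 hBm).2
  M_cover := by
    intro B P hB hP hPB
    obtain ⟨i, hi⟩ := h.exists_factor hB hP hPB
    exact ⟨_, Finset.mem_image_of_mem _ (Finset.mem_univ i), mem_trace.2 ⟨hP, hi⟩⟩
  M_card _ := Finset.card_image_le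
  rk_zero _ := finrank_vanishing_zero_le
  rk_pos := finrank_vanishing_pos (p := 1) ⟨by simp, by simp⟩ one_ne_zero
  rk_step := by
    rintro _ ⟨l, hl, rfl⟩ k N
    have h1 : N ∩ trace X l = (N ∩ X).filter (ev l · = 0) := by
      ext A; simp only [Finset.mem_inter, mem_trace, Finset.mem_filter]; tauto
    have h2 : N \ trace X l ∩ X = (N ∩ X).filter (ev l · ≠ 0) := by
      ext A; simp only [Finset.mem_inter, Finset.mem_sdiff, mem_trace, Finset.mem_filter]; tauto
    rw [h1, h2]
    exact finrank_vanishing_succ_le hl k (N ∩ X)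
  rk_mul := by
    rintro _ N N' ⟨l, hl, rfl⟩ hN k
    refine finrank_vanishing_mul hl fun A hA => ?_
    obtain ⟨hA, hAX⟩ := Finset.mem_inter.1 hA
    have := hN hA
    simp only [Finset.mem_union, mem_trace, Finset.mem_inter] at this ⊢
    tauto
  rk_X := by
    rw [Finset.inter_self, Submodule.finrank_eq_zero, Submodule.eq_bot_iff]
    exact fun p hp => h.poised.2.2 p hp.1 hp.2
  rk_users := by
    intro U m hU cm hm
    rw [Finset.inter_eq_left.2 (Finset.sdiff_subset.trans Finset.sdiff_subset)]
    exact h.card_users_le hU cm fun C hC => by simpa using hm C hC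
  cubic_used := by
    rintro _ _ _ G ⟨a, ha, rfl⟩ ⟨b, hb, rfl⟩ ⟨c, hc, rfl⟩ ca cb cc hab hac hbc hG hGa hGb hGc
    obtain ⟨i, hi⟩ :=
      h.exists_trace_eq_of_disjoint ha hb hc ca cb cc hab hac hbc hG hGa hGb hGc
    exact Finset.mem_image.2 ⟨i, Finset.mem_univ i, hi⟩

end IsFactored

theorem GCSet.exists_isFactored {X : Set (ℝ × ℝ)} (hX : GCSet 5 X) (hnm : NoMaximalLine 5 X) :
    ∃ (Y : Finset (ℝ × ℝ)) (f : ℝ × ℝ → Fin 5 → MvPolynomial (Fin 2) ℝ), Y = X ∧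
      IsFactored Y f := by
  obtain ⟨Y, rfl⟩ := hX.1.1.exists_finset_coe
  choose! p hp f hf hpf using hX.2
  exact ⟨Y, f, rfl, hX.1, hf, fun A hA => hpf A hA ▸ hp A hA, hnm⟩

/-- in a `GC_5` set with no maximal line, no node has m-distribution
sequence `(5,5,5,3,2)`. -/
theorem no_55532 (X : Set (ℝ × ℝ)) (hX : GCSet 5 X) (hnm : NoMaximalLine 5 X) :
    ∀ A ∈ X, ¬ HasMDSeq X A ![5, 5, 5, 3, 2] := by
  classical
  obtain ⟨Y, f, rfl, h⟩ := hX.exists_isFactored hnm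
  rintro A - ⟨L, ⟨hL, -⟩, hk⟩
  have hres (s : Fin 5) (hs : resCount Y L s (L s) = 5) :
      (trace Y (L s)).card = 5 ∧ ∀ i < s, Disjoint (trace Y (L i)) (trace Y (L s)) := by
    rw [resCount, show {B ∈ (Y : Set (ℝ × ℝ)) | ev (L s) B = 0 ∧ ∀ i : Fin 5, i < s → ev (L i) B ≠ 0}
      = ((trace Y (L s)).filter fun B => ∀ i < s, ev (L i) B ≠ 0 : Finset (ℝ × ℝ)) by
      ext B; simp [mem_trace, and_assoc], Set.ncard_coe_finset] at hs
    have h5 := h.card_trace_le (hL s)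
    have hle := Finset.card_filter_le (trace Y (L s)) fun B => ∀ i < s, ev (L i) B ≠ 0
    refine ⟨by omega, fun i hi => Finset.disjoint_right.2 fun B hB hB' => ?_⟩
    exact Finset.filter_card_eq (hs.trans (by omega)) B hB i hi (mem_trace.1 hB').2
  obtain ⟨c0, -⟩ := hres 0 (hk 0)
  obtain ⟨c1, d1⟩ := hres 1 (hk 1)
  obtain ⟨c2, d2⟩ := hres 2 (hk 2)
  exact LineConfig.not_isCubic (K := h.lineConfig) <| LineConfig.isCubic_of_disjoint
    ⟨_, hL 0, rfl⟩ ⟨_, hL 1, rfl⟩ ⟨_, hL 2, rfl⟩ c0 c1 c2 (d1 0 (by decide)) (d2 0 (by decide))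
    (d2 1 (by decide))
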